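/- arXiv:2407.19362 — 3 statements merged into one kernel-verified Lean document; each statement's English description precedes it below -/
import Mathlib

section
/- Let G be a connected graph in which every block is isomorphic to C5 (the cycle of length 5). Then G admits no odd 4-coloring. -/
open SimpleGraph

/-- A proper 4-coloring: adjacent vertices receive distinct colors. -/
def IsProper4 {V : Type*} (G : SimpleGraph V) (φ : V → Fin 4) : Prop :=
  ∀ ⦃u w : V⦄, G.Adj u w → φ u ≠ φ w

/-- The number of neighbors of `v` colored `i`. -/
noncomputable def nbrCount {V : Type*} (G : SimpleGraph V) (φ : V → Fin 4) (v : V) (i : Fin 4) : ℕ :=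
  {u | u ∈ G.neighborSet v ∧ φ u = i}.ncard

/-- `v` satisfies the odd condition: some color appears an odd number of times in `N(v)`. -/
def OddAt {V : Type*} (G : SimpleGraph V) (φ : V → Fin 4) (v : V) : Prop :=
  ∃ i : Fin 4, Odd (nbrCount G φ v i)

/-- `v` satisfies the even condition: some color `i ≠ φ v` appears an even number
of times (possibly zero) in `N(v)`. -/
def EvenAt {V : Type*} (G : SimpleGraph V) (φ : V → Fin 4) (v : V) : Prop :=
  ∃ i : Fin 4, i ≠ φ v ∧ Even (nbrCount G φ v i)

/-- An odd 4-coloring: a proper 4-coloring in which every non-isolated vertex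
satisfies the odd condition. -/
def IsOdd4Coloring {V : Type*} (G : SimpleGraph V) (φ : V → Fin 4) : Prop :=
  IsProper4 G φ ∧ ∀ v : V, (G.neighborSet v).Nonempty → OddAt G φ v

/-- The induced subgraph on `S` is connected and has no cut vertex. -/
def NoCutVtx {V : Type*} (G : SimpleGraph V) (S : Set V) : Prop :=
  (G.induce S).Connected ∧
    ∀ v ∈ S, (S \ {v}).Nonempty → (G.induce (S \ {v})).Connected

/-- A block of `G`: a maximal vertex set inducing a connected subgraph
with no cut vertex. -/
def IsBlock {V : Type*} (G : SimpleGraph V) (S : Set V) : Prop :=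
  NoCutVtx G S ∧ ∀ T : Set V, S ⊆ T → NoCutVtx G T → T = S

/-- The subgraph induced on `S` is isomorphic to the 5-cycle. -/
def IsC5Block {V : Type*} (G : SimpleGraph V) (S : Set V) : Prop :=
  Nonempty ((G.induce S) ≃g SimpleGraph.cycleGraph 5)

/-- If every vertex of `T` is joined inside `T` to the connected set `S`, then `T` is connected. -/
lemma connected_of_attach {V : Type*} {G : SimpleGraph V} {S T : Set V} (hST : S ⊆ T)
    (hS : (G.induce S).Connected)
    (h : ∀ y ∈ T, ∃ s ∈ S, ∃ q : G.Walk y s, ∀ z ∈ q.support, z ∈ T) :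
    (G.induce T).Connected := by
  obtain ⟨⟨s0, hs0⟩⟩ := hS.nonempty
  have key : ∀ y : T, (G.induce T).Reachable y ⟨s0, hST hs0⟩ := by
    rintro ⟨y, hy⟩
    obtain ⟨s, hs, q, hq⟩ := h y hy
    have h1 : (G.induce T).Reachable ⟨y, hy⟩ ⟨s, hST hs⟩ := ⟨q.induce T hq⟩
    have h2 : (G.induce S).Reachable ⟨s, hs⟩ ⟨s0, hs0⟩ := hS.preconnected _ _
    exact h1.trans (h2.map (SimpleGraph.induceHomOfLE G hST).toHom)
  have : Nonempty T := ⟨⟨s0, hST hs0⟩⟩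
  exact ⟨fun a b => (key a).trans (key b).symm⟩

/-- Adding a path between two distinct vertices keeps the set free of cut vertices. -/
lemma noCut_ear {V : Type*} {G : SimpleGraph V} {S : Set V} (hS : NoCutVtx G S)
    {a b : V} (ha : a ∈ S) (hb : b ∈ S) (hab : a ≠ b) (p : G.Walk a b) (hp : p.IsPath) :
    NoCutVtx G (S ∪ {z | z ∈ p.support}) := by
  classical
  constructor
  · refine connected_of_attach Set.subset_union_left hS.1 ?_
    rintro y (hy | hy)
    · exact ⟨y, hy, Walk.nil, by simp [hy]⟩
    · refine ⟨b, hb, p.dropUntil y hy, fun z hz => Or.inr (p.support_dropUntil_subset hy hz)⟩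
  · intro x _ _
    have hne : (S \ {x}).Nonempty := by
      by_cases h : a = x
      · exact ⟨b, hb, fun hh => hab (h.trans (Eq.symm hh))⟩
      · exact ⟨a, ha, h⟩
    have hc : (G.induce (S \ {x})).Connected := by
      by_cases hx : x ∈ S
      · exact hS.2 x hx hne
      · rw [Set.sdiff_singleton_eq_self hx]; exact hS.1
    refine connected_of_attach (Set.diff_subset_diff_left Set.subset_union_left) hc ?_
    rintro y ⟨hy | hy, hyx⟩
    · exact ⟨y, ⟨hy, hyx⟩, Walk.nil, by simpa using ⟨Or.inl hy, hyx⟩⟩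
    · by_cases h1 : x ∈ (p.takeUntil y hy).support
      · have h2 : x ∉ (p.dropUntil y hy).support := by
          intro h2
          have hsp := p.take_spec hy
          rw [← hsp] at hp
          have hd := hp.support_nodup
          rw [Walk.support_append, List.nodup_append] at hd
          rw [Walk.support_eq_cons, List.mem_cons] at h2
          rcases h2 with h2 | h2
          · exact hyx h2.symm
          · exact hd.2.2 x h1 x h2 rfl
        refine ⟨b, ⟨hb, ?_⟩, p.dropUntil y hy, fun z hz =>
          ⟨Or.inr (p.support_dropUntil_subset hy hz), ?_⟩⟩
        · rintro rfl; exact h2 (Walk.end_mem_support _)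
        · rintro rfl; exact h2 hz
      · refine ⟨a, ⟨ha, ?_⟩, (p.takeUntil y hy).reverse, fun z hz => ?_⟩
        · rintro rfl; exact h1 (Walk.start_mem_support _)
        · rw [Walk.support_reverse, List.mem_reverse] at hz
          refine ⟨Or.inr (p.support_takeUntil_subset hy hz), ?_⟩
          rintro rfl; exact h1 hz

lemma block_ear {V : Type*} {G : SimpleGraph V} {S : Set V} (hS : IsBlock G S)
    {v u w : V} (hv : v ∈ S) (hu : u ∈ S) (huv : u ≠ v) (hvw : G.Adj v w)
    (q : G.Walk w u) (hq : v ∉ q.support) : w ∈ S := by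
  classical
  have hp : (Walk.cons hvw q.bypass).IsPath := by
    rw [Walk.cons_isPath_iff]
    exact ⟨q.bypass_isPath, fun h => hq (q.support_bypass_subset_support h)⟩
  have := hS.2 _ Set.subset_union_left (noCut_ear hS.1 hv hu huv.symm _ hp)
  rw [← this]
  right
  simp

lemma block_union {V : Type*} {G : SimpleGraph V} {S T : Set V} (hS : IsBlock G S)
    (hT : IsBlock G T) {a b : V} (hab : a ≠ b) (haS : a ∈ S) (haT : a ∈ T) (hbS : b ∈ S)
    (hbT : b ∈ T) : S = T := by
  have hU : NoCutVtx G (S ∪ T) := by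
    constructor
    · exact induce_union_connected hS.1.1.preconnected hT.1.1.preconnected ⟨a, haS, haT⟩
    · intro x _ _
      have hc : ∀ R : Set V, NoCutVtx G R → a ∈ R → b ∈ R → (G.induce (R \ {x})).Connected := by
        intro R hR ha hb
        by_cases hx : x ∈ R
        · refine hR.2 x hx ?_
          by_cases h : a = x
          · exact ⟨b, hb, fun hh => hab (h.trans (Eq.symm hh))⟩
          · exact ⟨a, ha, h⟩
        · rw [Set.sdiff_singleton_eq_self hx]; exact hR.1
      rw [Set.union_diff_distrib]
      refine induce_union_connected (hc S hS.1 haS hbS).preconnected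
        (hc T hT.1 haT hbT).preconnected ?_
      by_cases h : a = x
      · have : b ≠ x := fun hh => hab (h.trans (Eq.symm hh))
        exact ⟨b, ⟨hbS, this⟩, ⟨hbT, this⟩⟩
      · exact ⟨a, ⟨haS, h⟩, ⟨haT, h⟩⟩
  have h1 := hS.2 _ Set.subset_union_left hU
  have h2 := hT.2 _ Set.subset_union_right hU
  exact h1.symm.trans h2

lemma exists_block {V : Type*} [Fintype V] {G : SimpleGraph V} {S : Set V} (hS : NoCutVtx G S) :
    ∃ T, S ⊆ T ∧ IsBlock G T := by
  obtain ⟨T, hST, hT⟩ := (Set.toFinite {T : Set V | NoCutVtx G T}).exists_le_maximal hS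
  refine ⟨T, hST, hT.prop, fun R hR hRn => ?_⟩
  exact (hT.eq_of_le hRn hR).symm

lemma noCut_pair {V : Type*} {G : SimpleGraph V} {a b : V} (h : G.Adj a b) :
    NoCutVtx G {a, b} := by
  refine ⟨induce_pair_connected_of_adj h, ?_⟩
  rintro v hv hne
  have hs : ({a, b} \ {v} : Set V).Subsingleton := by
    rintro x ⟨hx, hx'⟩ y ⟨hy, hy'⟩
    simp only [Set.mem_insert_iff, Set.mem_singleton_iff] at *
    grind
  obtain ⟨x, hx⟩ := hne
  rw [hs.eq_singleton_of_mem hx]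
  have : Subsingleton ({x} : Set V) := by infer_instance
  have : Nonempty ({x} : Set V) := ⟨⟨x, rfl⟩⟩
  exact ⟨Preconnected.of_subsingleton⟩

lemma noCut_single {V : Type*} {G : SimpleGraph V} (a : V) :
    NoCutVtx G {a} := by
  have : Nonempty ({a} : Set V) := ⟨⟨a, rfl⟩⟩
  refine ⟨⟨Preconnected.of_subsingleton⟩, ?_⟩
  rintro v hv ⟨x, hx, hx'⟩
  exact absurd (hx.trans hv.symm) hx'

lemma c5_param {V : Type*} {G : SimpleGraph V} {S : Set V} (h : IsC5Block G S) :
    ∃ f : Fin 5 → V, Function.Injective f ∧ (∀ v, v ∈ S ↔ ∃ i, f i = v) ∧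
      ∀ i j, G.Adj (f i) (f j) ↔ (j = i + 1 ∨ j = i - 1) := by
  obtain ⟨e⟩ := h
  refine ⟨fun i => (e.symm i : V), ?_, ?_, ?_⟩
  · intro i j hij
    exact e.symm.injective (Subtype.ext hij)
  · intro v
    constructor
    · intro hv
      exact ⟨e ⟨v, hv⟩, by simp⟩
    · rintro ⟨i, rfl⟩
      exact (e.symm i).2
  · intro i j
    have h1 : G.Adj (e.symm i : V) (e.symm j : V) ↔ (cycleGraph 5).Adj i j := by
      rw [← e.symm.map_adj_iff]; rfl
    rw [h1]
    clear h1
    revert i j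
    decide

lemma c5_color : ∀ a b c d e : Fin 4, a ≠ b → b ≠ c → c ≠ d → d ≠ e → e ≠ a →
    (e = b ∨ a = c ∨ b = d ∨ c = e ∨ d = a) := by
  intro a b c d e
  omega

/-- The two neighbors of `v` in the block `S` get different colors. -/
def BadFlag {V : Type*} (G : SimpleGraph V) (φ : V → Fin 4) (v : V) (S : Set V) : Prop :=
  ∃ a ∈ S, ∃ b ∈ S, G.Adj v a ∧ G.Adj v b ∧ φ a ≠ φ b

lemma c5_exists_good {V : Type*} {G : SimpleGraph V} {S : Set V} (h : IsC5Block G S)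
    {φ : V → Fin 4} (hφ : IsProper4 G φ) : ∃ v ∈ S, ¬ BadFlag G φ v S := by
  obtain ⟨f, hinj, hS, hadj⟩ := c5_param h
  have hc : ∀ i, φ (f i) ≠ φ (f (i + 1)) := fun i => hφ ((hadj _ _).2 (Or.inl rfl))
  have : ∃ i, φ (f (i - 1)) = φ (f (i + 1)) := by
    rcases c5_color _ _ _ _ _ (hc 0) (hc 1) (hc 2) (hc 3) (hc 4) with h | h | h | h | h
    · exact ⟨0, h⟩
    · exact ⟨1, h⟩
    · exact ⟨2, h⟩
    · exact ⟨3, h⟩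
    · exact ⟨4, h⟩
  obtain ⟨i, hi⟩ := this
  refine ⟨f i, (hS _).2 ⟨i, rfl⟩, ?_⟩
  rintro ⟨a, ha, b, hb, hia, hib, hne⟩
  obtain ⟨j, rfl⟩ := (hS _).1 ha
  obtain ⟨k, rfl⟩ := (hS _).1 hb
  rw [hadj] at hia hib
  rcases hia with rfl | rfl <;> rcases hib with rfl | rfl
  · exact hne rfl
  · exact hne hi.symm
  · exact hne hi
  · exact hne rfl

lemma c5_mate {V : Type*} {G : SimpleGraph V} {S : Set V} (h : IsC5Block G S)
    {v u : V} (hv : v ∈ S) (hu : u ∈ S) (hvu : G.Adj v u) :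
    ∃ w ∈ S, G.Adj v w ∧ w ≠ u ∧ ∀ z ∈ S, G.Adj v z → z = u ∨ z = w := by
  obtain ⟨f, hinj, hS, hadj⟩ := c5_param h
  obtain ⟨i, rfl⟩ := (hS _).1 hv
  obtain ⟨j, rfl⟩ := (hS _).1 hu
  have hpm : i + 1 ≠ i - 1 := by
    clear * -
    revert i
    decide
  rcases (hadj _ _).1 hvu with rfl | rfl
  · refine ⟨f (i - 1), (hS _).2 ⟨_, rfl⟩, (hadj _ _).2 (Or.inr rfl), fun h => hpm (hinj h).symm, ?_⟩
    intro z hz hvz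
    obtain ⟨k, rfl⟩ := (hS _).1 hz
    rcases (hadj _ _).1 hvz with rfl | rfl <;> simp
  · refine ⟨f (i + 1), (hS _).2 ⟨_, rfl⟩, (hadj _ _).2 (Or.inl rfl), fun h => hpm (hinj h), ?_⟩
    intro z hz hvz
    obtain ⟨k, rfl⟩ := (hS _).1 hz
    rcases (hadj _ _).1 hvz with rfl | rfl <;> simp

lemma c5_nbr {V : Type*} {G : SimpleGraph V} {S : Set V} (h : IsC5Block G S)
    {v : V} (hv : v ∈ S) : ∃ u ∈ S, G.Adj v u := by
  obtain ⟨f, hinj, hS, hadj⟩ := c5_param h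
  obtain ⟨i, rfl⟩ := (hS _).1 hv
  exact ⟨f (i + 1), (hS _).2 ⟨_, rfl⟩, (hadj _ _).2 (Or.inl rfl)⟩

lemma exists_bad {V : Type*} [Fintype V] {G : SimpleGraph V}
    (hblocks : ∀ S : Set V, IsBlock G S → IsC5Block G S) {φ : V → Fin 4} {v : V}
    (hv : OddAt G φ v) : ∃ S, IsBlock G S ∧ v ∈ S ∧ BadFlag G φ v S := by
  classical
  by_contra hcon
  push Not at hcon
  obtain ⟨i, hi⟩ := hv
  have hmate : ∀ u, ∃ w, G.Adj v u → (G.Adj v w ∧ w ≠ u ∧ φ w = φ u ∧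
      ∃ S, IsBlock G S ∧ v ∈ S ∧ u ∈ S ∧ w ∈ S ∧ ∀ z ∈ S, G.Adj v z → z = u ∨ z = w) := by
    intro u
    by_cases huv : G.Adj v u
    · obtain ⟨S, hsub, hS⟩ := exists_block (noCut_pair huv)
      have hvS : v ∈ S := hsub (by simp)
      have huS : u ∈ S := hsub (by simp)
      obtain ⟨w, hw, hvw, hne, hall⟩ := c5_mate (hblocks S hS) hvS huS huv
      refine ⟨w, fun _ => ⟨hvw, hne, ?_, S, hS, hvS, huS, hw, hall⟩⟩
      by_contra hc
      exact hcon S hS hvS ⟨w, hw, u, huS, hvw, huv, hc⟩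
    · exact ⟨u, fun h => absurd h huv⟩
  choose m hm using hmate
  have hinv : ∀ u, G.Adj v u → m (m u) = u := by
    intro u hu
    obtain ⟨h1, h2, -, S, hS, hvS, huS, hwS, hall⟩ := hm u hu
    obtain ⟨h1', h2', -, S', hS', hvS', huS', hwS', -⟩ := hm (m u) h1
    have : S = S' := block_union hS hS' h1.ne hvS hvS' hwS huS'
    subst this
    rcases hall _ hwS' h1' with h | h
    · exact h
    · exact absurd h h2'
  have hev : Even (nbrCount G φ v i) := by
    unfold nbrCount
    rw [Set.ncard_eq_toFinset_card']
    rw [← ZMod.natCast_eq_zero_iff_even]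
    rw [Finset.card_eq_sum_ones, Nat.cast_sum]
    refine Finset.sum_involution (fun u _ => m u) ?_ ?_ ?_ ?_
    · intro a _; decide
    · intro a ha _
      simp only [Set.mem_toFinset, Set.mem_setOf_eq, mem_neighborSet] at ha
      exact (hm a ha.1).2.1
    · intro a ha
      simp only [Set.mem_toFinset, Set.mem_setOf_eq, mem_neighborSet] at ha ⊢
      exact ⟨(hm a ha.1).1, (hm a ha.1).2.2.1.trans ha.2⟩
    · intro a ha
      simp only [Set.mem_toFinset, Set.mem_setOf_eq, mem_neighborSet] at ha
      exact hinv a ha.1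
  exact (Nat.not_even_iff_odd.2 hi) hev

lemma walk_avoid {V : Type*} {G : SimpleGraph V} (hconn : G.Connected) {r u v : V} (huv : u ≠ v)
    (hd : G.dist u r ≤ G.dist v r) : ∃ p : G.Walk u r, v ∉ p.support := by
  classical
  obtain ⟨p, hp⟩ := hconn.exists_walk_length_eq_dist u r
  refine ⟨p, fun hv => ?_⟩
  have h1 := congrArg Walk.length (p.take_spec hv)
  rw [Walk.length_append] at h1
  have h2 := SimpleGraph.dist_le (p.dropUntil v hv)
  have h3 : (p.takeUntil v hv).length ≠ 0 := fun h => huv (Walk.eq_of_length_eq_zero h)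
  omega

lemma closest {V : Type*} {G : SimpleGraph V} (hconn : G.Connected)
    {r u v u' : V} {S S' : Set V} (hS : IsBlock G S) (hS' : IsBlock G S')
    (hC : IsC5Block G S) (hne : S ≠ S')
    (hvS : v ∈ S) (huS : u ∈ S) (huv : u ≠ v) (hd : G.dist u r ≤ G.dist v r)
    (hvS' : v ∈ S') (huS' : u' ∈ S') (huv' : u' ≠ v) : G.dist v r < G.dist u' r := by
  by_contra hcon
  push Not at hcon
  obtain ⟨p, hp⟩ := walk_avoid hconn huv hd
  obtain ⟨p', hp'⟩ := walk_avoid hconn huv' hcon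
  obtain ⟨w, hwS, hvw⟩ := c5_nbr hC hvS
  have hconnS := hS.1.2 v hvS ⟨u, huS, huv⟩
  obtain ⟨q⟩ := hconnS.preconnected ⟨w, hwS, hvw.ne'⟩ ⟨u, huS, huv⟩
  let q' : G.Walk w u := q.map (SimpleGraph.Embedding.induce (S \ {v})).toHom
  have hq' : v ∉ q'.support := by
    intro h
    have h' := h
    erw [Walk.support_map] at h'
    obtain ⟨x, -, hx⟩ := List.mem_map.1 h'
    exact x.2.2 hx
  have hwS' : w ∈ S' := by
    refine block_ear hS' hvS' huS' huv' hvw (q'.append (p.append p'.reverse)) ?_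
    simp only [Walk.mem_support_append_iff, Walk.support_reverse, List.mem_reverse]
    tauto
  exact hne (block_union hS hS' hvw.ne hvS hvS' hwS hwS')

theorem c5_block_graph_not_odd4colorable {V : Type*} [Fintype V]
    (G : SimpleGraph V) (hconn : G.Connected)
    (hblocks : ∀ S : Set V, IsBlock G S → IsC5Block G S) :
    ¬ ∃ φ : V → Fin 4, IsOdd4Coloring G φ := by
  rintro ⟨φ, hprop, hodd⟩
  have hbad : ∀ v, ∃ S, IsBlock G S ∧ v ∈ S ∧ BadFlag G φ v S := by
    intro v
    apply exists_bad hblocks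
    apply hodd
    obtain ⟨S, hsub, hS⟩ := exists_block (noCut_single (G := G) v)
    obtain ⟨u, -, hu⟩ := c5_nbr (hblocks S hS) (hsub rfl)
    exact ⟨u, hu⟩
  choose β hβ hvβ hbβ using hbad
  obtain ⟨r⟩ := hconn.nonempty
  let A : Set V := {v | ∀ u ∈ β v, u ≠ v → G.dist v r < G.dist u r}
  have hr : r ∈ A := by
    intro u _ hu
    rw [SimpleGraph.dist_self]
    exact hconn.pos_dist_of_ne hu
  obtain ⟨v, hvA, hmax⟩ := Set.exists_max_image A (fun v => G.dist v r) (Set.toFinite A) ⟨r, hr⟩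
  obtain ⟨w, hw, hgood⟩ := c5_exists_good (hblocks _ (hβ v)) hprop
  have hwv : w ≠ v := by
    rintro rfl
    exact hgood (hbβ w)
  have hlt := hvA w hw hwv
  have hne : β v ≠ β w := by
    intro h
    rw [h] at hgood
    exact hgood (hbβ w)
  have hwA : w ∈ A := by
    intro u hu huw
    exact closest hconn (hβ v) (hβ w) (hblocks _ (hβ v)) hne hw (hvβ v) hwv.symm hlt.le
      (hvβ w) hu huw
  exact absurd (hmax w hwA) (not_le.2 hlt)
end

section
/- Let G be a connected graph in which every block is isomorphic to C5, and let v be any vertex of G. Then there exists a proper 4-coloring φ of G such that every vertex u ≠ v satisfies the odd condition, and v satisfies the even condition with respect to φ. -/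
open SimpleGraph

namespace C5Aux

/-- walk-connected set -/
def Cn {V : Type*} (G : SimpleGraph V) (C : Set V) : Prop :=
  ∀ x ∈ C, ∀ y ∈ C, ∃ p : G.Walk x y, ∀ z ∈ p.support, z ∈ C

theorem connected_iff {V : Type*} (G : SimpleGraph V) (C : Set V) :
    (G.induce C).Connected ↔ Cn G C ∧ C.Nonempty := by
  constructor
  · intro h
    refine ⟨?_, ?_⟩
    · intro x hx y hy
      obtain ⟨p⟩ := h.preconnected ⟨x, hx⟩ ⟨y, hy⟩
      refine ⟨p.map (Embedding.induce C).toHom, ?_⟩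
      intro z hz
      have hz' := (Walk.support_map (Embedding.induce C).toHom p) ▸ hz
      obtain ⟨a, _, rfl⟩ := List.mem_map.1 hz'
      exact a.2
    · obtain ⟨x⟩ := h.nonempty
      exact ⟨x.1, x.2⟩
  · rintro ⟨h, ⟨x, hx⟩⟩
    have : Nonempty C := ⟨⟨x, hx⟩⟩
    refine ⟨?_⟩
    rintro ⟨a, ha⟩ ⟨b, hb⟩
    obtain ⟨p, hp⟩ := h a ha b hb
    exact ⟨p.induce C hp⟩

theorem cn_of_attach {V : Type*} (G : SimpleGraph V) (A C : Set V) (hA : Cn G A) (hAC : A ⊆ C)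
    (h : ∀ y ∈ C, ∃ a ∈ A, ∃ p : G.Walk y a, ∀ z ∈ p.support, z ∈ C) : Cn G C := by
  intro x hx y hy
  obtain ⟨a, ha, p, hp⟩ := h x hx
  obtain ⟨b, hb, q, hq⟩ := h y hy
  obtain ⟨r, hr⟩ := hA a ha b hb
  refine ⟨(p.append r).append q.reverse, ?_⟩
  intro z hz
  simp only [Walk.mem_support_append_iff, Walk.support_reverse, List.mem_reverse] at hz
  rcases hz with (hz | hz) | hz
  · exact hp z hz
  · exact hAC (hr z hz)
  · exact hq z hz

theorem path_split {V : Type*} {G : SimpleGraph V} {s t : V} (p : G.Walk s t) (hp : p.IsPath)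
    (x y : V) (hy : y ∈ p.support) (hxy : y ≠ x) :
    (∃ q : G.Walk y s, ∀ z ∈ q.support, z ∈ p.support ∧ z ≠ x) ∨
    (∃ q : G.Walk y t, ∀ z ∈ q.support, z ∈ p.support ∧ z ≠ x) := by
  classical
  by_cases h : x ∈ (p.takeUntil y hy).support
  · right
    refine ⟨p.dropUntil y hy, fun z hz => ⟨p.support_dropUntil_subset_support hy hz, ?_⟩⟩
    rintro rfl
    have h1 := hp.support_nodup
    rw [← p.take_spec hy, Walk.support_append, List.nodup_append] at h1
    have h2 : z ∈ (p.dropUntil y hy).support.tail := by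
      rw [Walk.mem_support_iff] at hz
      rcases hz with hz | hz
      · exact absurd hz.symm hxy
      · exact hz
    exact h1.2.2 z h z h2 rfl
  · left
    refine ⟨(p.takeUntil y hy).reverse, fun z hz => ?_⟩
    rw [Walk.support_reverse, List.mem_reverse] at hz
    exact ⟨p.support_takeUntil_subset_support hy hz, fun h' => h (h' ▸ hz)⟩

theorem noCut_union_path {V : Type*} {G : SimpleGraph V} {B : Set V} (hB : NoCutVtx G B)
    {s t : V} (hs : s ∈ B) (ht : t ∈ B) (hst : s ≠ t) (p : G.Walk s t) (hp : p.IsPath) :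
    NoCutVtx G (B ∪ {z | z ∈ p.support}) := by
  classical
  refine ⟨?_, ?_⟩
  · rw [connected_iff]
    refine ⟨cn_of_attach G B _ ((connected_iff G B).1 hB.1).1 Set.subset_union_left ?_, ⟨s, Or.inl hs⟩⟩
    rintro y (hy | hy)
    · exact ⟨y, hy, Walk.nil, by simpa using Or.inl hy⟩
    · exact ⟨t, ht, p.dropUntil y hy, fun z hz => Or.inr (p.support_dropUntil_subset_support hy hz)⟩
  · intro x _ hne
    rw [connected_iff]
    refine ⟨?_, hne⟩
    have hBx : Cn G (B \ {x}) := by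
      rintro a ha
      by_cases hx : x ∈ B
      · exact ((connected_iff G _).1 (hB.2 x hx ⟨a, ha⟩)).1 a ha
      · rw [Set.diff_singleton_eq_self hx] at ha ⊢
        exact ((connected_iff G B).1 hB.1).1 a ha
    refine cn_of_attach G (B \ {x}) _ hBx (Set.diff_subset_diff_left Set.subset_union_left) ?_
    rintro y ⟨hy | hy, hyx⟩
    · refine ⟨y, ⟨hy, hyx⟩, Walk.nil, ?_⟩
      intro z hz
      rw [Walk.support_nil, List.mem_singleton] at hz
      subst hz
      exact ⟨Or.inl hy, hyx⟩
    · rcases path_split p hp x y hy hyx with ⟨q, hq⟩ | ⟨q, hq⟩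
      · exact ⟨s, ⟨hs, (hq s q.end_mem_support).2⟩, q, fun z hz => ⟨Or.inr (hq z hz).1, (hq z hz).2⟩⟩
      · exact ⟨t, ⟨ht, (hq t q.end_mem_support).2⟩, q, fun z hz => ⟨Or.inr (hq z hz).1, (hq z hz).2⟩⟩

theorem block_no_ear {V : Type*} {G : SimpleGraph V} {B : Set V} (hB : IsBlock G B)
    {s t c d : V} (hs : s ∈ B) (ht : t ∈ B) (q : G.Walk c d) (hq : ∀ z ∈ q.support, z ∉ B)
    (h1 : G.Adj s c) (h2 : G.Adj d t) : s = t := by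
  classical
  by_contra hst
  have hsub := q.support_bypass_subset_support
  have hpath : ((q.bypass.concat h2).cons h1).IsPath := by
    rw [Walk.cons_isPath_iff, Walk.concat_isPath_iff]
    refine ⟨⟨q.bypass_isPath, fun h => hq _ (hsub h) ht⟩, ?_⟩
    rw [Walk.support_concat]
    intro h
    simp only [List.mem_append, List.mem_singleton] at h
    rcases h with h | h
    · exact hq _ (hsub h) hs
    · exact hst h
  have h3 := hB.2 _ Set.subset_union_left (noCut_union_path hB.1 hs ht hst _ hpath)
  have h4 : c ∈ B := by
    rw [← h3]
    right
    simp
  exact hq c q.start_mem_support h4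

theorem exists_block {V : Type*} [Fintype V] {G : SimpleGraph V} {u w : V} (h : G.Adj u w) :
    ∃ B, IsBlock G B ∧ u ∈ B ∧ w ∈ B := by
  have h0 : NoCutVtx G {u, w} := by
    refine ⟨?_, ?_⟩
    · rw [connected_iff]
      refine ⟨?_, ⟨u, by simp⟩⟩
      rintro x (rfl | rfl) y (rfl | rfl)
      · exact ⟨Walk.nil, by simp⟩
      · exact ⟨h.toWalk, by simp⟩
      · exact ⟨h.symm.toWalk, by simp⟩
      · exact ⟨Walk.nil, by simp⟩
    · intro x hx hne
      rw [connected_iff]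
      refine ⟨?_, hne⟩
      intro a ha b hb
      have hab : a = b := by
        simp only [Set.mem_diff, Set.mem_insert_iff, Set.mem_singleton_iff] at hx ha hb
        grind
      subst hab
      exact ⟨Walk.nil, by simpa using ha⟩
  obtain ⟨B, hle, hB⟩ := (Set.toFinite {T : Set V | NoCutVtx G T}).exists_le_maximal h0
  refine ⟨B, ⟨hB.1, fun T hT hT2 => (Set.Subset.antisymm (hB.2 hT2 hT) hT)⟩, hle (by simp), hle (by simp)⟩

theorem first_entry {V : Type*} {G : SimpleGraph V} (S : Set V) {w t : V} (p : G.Walk w t) :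
    w ∉ S → t ∈ S → ∃ c s, ∃ q : G.Walk w c, (∀ z ∈ q.support, z ∉ S) ∧ G.Adj c s ∧ s ∈ S ∧
      s ∈ p.support := by
  induction p with
  | nil => intro h h'; exact absurd h' h
  | @cons a b _ hab p ih =>
    intro ha ht
    by_cases hb : b ∈ S
    · exact ⟨a, b, Walk.nil, by simpa using ha, hab, hb, by simp⟩
    · obtain ⟨c, s, q, hq, h1, h2, h3⟩ := ih hb ht
      refine ⟨c, s, q.cons hab, ?_, h1, h2, ?_⟩
      · intro z hz
        rw [Walk.support_cons, List.mem_cons] at hz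
        rcases hz with rfl | hz
        · exact ha
        · exact hq z hz
      · rw [Walk.support_cons]; exact List.mem_cons_of_mem _ h3

/-- color pattern along the 5-cycle, starting at the root -/
def pat : Fin 5 → Fin 4 := ![0, 1, 2, 3, 1]

theorem c5_param {V : Type*} {G : SimpleGraph V} {B : Set V} (h : IsC5Block G B) {u : V}
    (hu : u ∈ B) : ∃ g : Fin 5 → V, Function.Injective g ∧ Set.range g = B ∧ g 0 = u ∧
      ∀ i j, G.Adj (g i) (g j) ↔ (cycleGraph 5).Adj i j := by
  obtain ⟨e⟩ := h
  refine ⟨fun j => (e.symm (j + e ⟨u, hu⟩)).1, ?_, ?_, ?_, ?_⟩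
  · intro i j hij
    have := e.symm.injective (Subtype.ext hij)
    exact add_right_cancel this
  · ext b
    constructor
    · rintro ⟨j, rfl⟩
      exact (e.symm (j + e ⟨u, hu⟩)).2
    · intro hb
      exact ⟨e ⟨b, hb⟩ - e ⟨u, hu⟩, by simp⟩
  · simp
  · intro i j
    have h1 : ∀ k i j : Fin 5, (cycleGraph 5).Adj (i + k) (j + k) ↔ (cycleGraph 5).Adj i j := by
      decide
    rw [← h1 (e ⟨u, hu⟩) i j, ← e.symm.map_adj_iff]
    rfl

/-- number of neighbours of `a` in `S` with colour `i` -/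
noncomputable def cnt {V : Type*} (G : SimpleGraph V) (S : Set V) (φ : V → Fin 4) (a : V)
    (i : Fin 4) : ℕ := {b | b ∈ S ∧ G.Adj a b ∧ φ b = i}.ncard

theorem cnt_block {V : Type*} {G : SimpleGraph V} {B : Set V} {g : Fin 5 → V}
    (hg : Function.Injective g) (hr : Set.range g = B)
    (hadj : ∀ i j, G.Adj (g i) (g j) ↔ (cycleGraph 5).Adj i j) (ψ : V → Fin 4) (x : Fin 4)
    (hψ : ∀ j, ψ (g j) = x + pat j) (j : Fin 5) (i : Fin 4) :
    cnt G B ψ (g j) i =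
      (Finset.univ.filter fun k : Fin 5 => (cycleGraph 5).Adj j k ∧ x + pat k = i).card := by
  unfold cnt
  rw [← Set.ncard_coe_finset, ← Set.ncard_image_of_injective _ hg]
  congr 1
  ext b
  simp only [Set.mem_ofPred_eq, Set.mem_image, Finset.coe_filter, Finset.mem_univ, true_and]
  constructor
  · rintro ⟨h1, h2, h3⟩
    rw [← hr] at h1
    obtain ⟨k, rfl⟩ := h1
    exact ⟨k, ⟨(hadj _ _).1 h2, (hψ k) ▸ h3⟩, rfl⟩
  · rintro ⟨k, ⟨h1, h2⟩, rfl⟩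
    exact ⟨hr ▸ ⟨k, rfl⟩, (hadj _ _).2 h1, (hψ k).trans h2⟩

theorem pat_even : ∀ (x i : Fin 4),
    Even (Finset.univ.filter fun k : Fin 5 => (cycleGraph 5).Adj 0 k ∧ x + pat k = i).card := by
  decide

theorem pat_odd : ∀ (x : Fin 4) (j : Fin 5), j ≠ 0 → ∃ i,
    Odd (Finset.univ.filter fun k : Fin 5 => (cycleGraph 5).Adj j k ∧ x + pat k = i).card := by
  decide

theorem pat_proper : ∀ (x : Fin 4) (i j : Fin 5), (cycleGraph 5).Adj i j →
    x + pat i ≠ x + pat j := by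
  decide

/-- each outside component attaches at one vertex -/
def Att {V : Type*} (G : SimpleGraph V) (S : Set V) : Prop :=
  ∀ ⦃c d : V⦄ (q : G.Walk c d), (∀ z ∈ q.support, z ∉ S) →
    ∀ s ∈ S, ∀ t ∈ S, G.Adj s c → G.Adj d t → s = t

def Good {V : Type*} (G : SimpleGraph V) (v : V) (S : Set V) : Prop :=
  v ∈ S ∧ Att G S ∧ ∃ φ : V → Fin 4, (∀ a ∈ S, ∀ b ∈ S, G.Adj a b → φ a ≠ φ b) ∧
    (∀ a ∈ S, a ≠ v → ∃ i, Odd (cnt G S φ a i)) ∧ ∀ i, Even (cnt G S φ v i)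

theorem good_base {V : Type*} (G : SimpleGraph V) (v : V) : Good G v {v} := by
  refine ⟨rfl, ?_, fun _ => 0, ?_, ?_, ?_⟩
  · rintro c d q _ s rfl t rfl _ _
    rfl
  · rintro a rfl b rfl h
    exact absurd h (G.loopless.irrefl _)
  · intro a ha h
    exact absurd ha h
  · intro i
    have : {b | b ∈ ({v} : Set V) ∧ G.Adj v b ∧ (fun _ : V => (0 : Fin 4)) b = i} = ∅ := by
      ext b
      simp only [Set.mem_singleton_iff, Set.mem_ofPred_eq, Set.mem_empty_iff_false, iff_false]
      rintro ⟨rfl, h, _⟩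
      exact G.loopless.irrefl _ h
    unfold cnt
    rw [this]
    simp

theorem att_step {V : Type*} {G : SimpleGraph V} {S B : Set V} {u w : V} (hS : Att G S)
    (hB : IsBlock G B) (hu : u ∈ S) (hw : w ∉ S) (huw : G.Adj u w) (huB : u ∈ B) (hwB : w ∈ B) :
    (∀ b ∈ B, b ≠ u → b ∉ S) ∧ (∀ b ∈ B, b ≠ u → ∀ s ∈ S, G.Adj b s → s = u) ∧
      Att G (S ∪ B) := by
  have hwu : w ∈ B \ {u} := ⟨hwB, huw.ne'⟩
  have hCn : Cn G (B \ {u}) := ((connected_iff G _).1 (hB.1.2 u huB ⟨w, hwu⟩)).1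
  have h1 : ∀ b ∈ B, b ≠ u → b ∉ S := by
    intro b hb hbu hbS
    obtain ⟨p, hp⟩ := hCn w hwu b ⟨hb, hbu⟩
    obtain ⟨c, s, q, hq, hcs, hs, hsp⟩ := first_entry S p hw hbS
    exact (hp s hsp).2 (hS q hq u hu s hs huw hcs).symm
  refine ⟨h1, ?_, ?_⟩
  · intro b hb hbu s hs hbs
    obtain ⟨p, hp⟩ := hCn w hwu b ⟨hb, hbu⟩
    exact (hS p (fun z hz => h1 z (hp z hz).1 (hp z hz).2) u hu s hs huw hbs).symm
  · have key : ∀ ⦃c d : V⦄ (q : G.Walk c d), (∀ z ∈ q.support, z ∉ S ∪ B) →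
        ∀ s ∈ S, ∀ t ∈ B, t ≠ u → G.Adj s c → G.Adj d t → s = u := by
      intro c d q hq s hs t ht htu hsc hdt
      obtain ⟨p, hp⟩ := hCn t ⟨ht, htu⟩ w hwu
      refine hS (q.append (p.cons hdt)) ?_ s hs u hu hsc huw.symm
      intro z hz
      rw [Walk.mem_support_append_iff, Walk.support_cons, List.mem_cons] at hz
      rcases hz with hz | rfl | hz
      · exact fun h => hq z hz (Or.inl h)
      · exact fun h => hq z q.end_mem_support (Or.inl h)
      · exact h1 z (hp z hz).1 (hp z hz).2
    intro c d q hq s hs t ht hsc hdt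
    have hqB : ∀ z ∈ q.support, z ∉ B := fun z hz h => hq z hz (Or.inr h)
    have hqS : ∀ z ∈ q.support, z ∉ S := fun z hz h => hq z hz (Or.inl h)
    by_cases hsS : s ∈ S
    · by_cases htS : t ∈ S
      · exact hS q hqS s hsS t htS hsc hdt
      · have htB : t ∈ B := ht.resolve_left htS
        have : s = u := key q hq s hsS t htB (fun h => htS (h ▸ hu)) hsc hdt
        exact block_no_ear hB (this ▸ huB) htB q hqB hsc hdt
    · have hsB : s ∈ B := hs.resolve_left hsS
      have htB : t ∈ B := by
        by_cases htS : t ∈ S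
        · have : t = u := key q.reverse (by simpa using hq) t htS s hsB (fun h => hsS (h ▸ hu))
            hdt.symm hsc.symm
          exact this ▸ huB
        · exact ht.resolve_left htS
      exact block_no_ear hB hsB htB q hqB hsc hdt

theorem good_step {V : Type*} [Fintype V] {G : SimpleGraph V} {v : V} {S B : Set V} {u w : V}
    (hS : Good G v S) (hB : IsBlock G B) (hC : IsC5Block G B) (hu : u ∈ S) (hw : w ∉ S)
    (huw : G.Adj u w) (huB : u ∈ B) (hwB : w ∈ B) : Good G v (S ∪ B) := by
  classical
  obtain ⟨hv, hatt, φ, hprop, hodd, heven⟩ := hS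
  obtain ⟨h1, h2, h3⟩ := att_step hatt hB hu hw huw huB hwB
  obtain ⟨g, hg, hr, hg0, hadj⟩ := c5_param hC huB
  have hgB : ∀ j, g j ∈ B := fun j => hr ▸ ⟨j, rfl⟩
  obtain ⟨ψ, hψg, hψS⟩ : ∃ ψ : V → Fin 4, (∀ j, ψ (g j) = φ u + pat j) ∧ ∀ a ∈ S, ψ a = φ a := by
    refine ⟨fun b => if h : ∃ j, g j = b then φ u + pat h.choose else φ b, ?_, ?_⟩
    · intro j
      have h : ∃ k, g k = g j := ⟨j, rfl⟩
      simp only [dif_pos h]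
      rw [hg h.choose_spec]
    · intro a ha
      by_cases h : ∃ j, g j = a
      · have hau : a = u := by
          by_contra hau
          obtain ⟨j, rfl⟩ := h
          exact h1 _ (hgB j) hau ha
        simp only [dif_pos h]
        have : h.choose = 0 := hg (by rw [h.choose_spec, hg0, hau])
        rw [this, hau]
        simp [pat]
      · simp only [dif_neg h]
  -- counts
  have cS : ∀ a ∈ S, a ≠ u → ∀ i, cnt G (S ∪ B) ψ a i = cnt G S φ a i := by
    intro a ha hau i
    unfold cnt
    congr 1
    ext b
    simp only [Set.mem_ofPred_eq, Set.mem_union]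
    constructor
    · rintro ⟨hb, hab, hc⟩
      have hbS : b ∈ S := by
        by_contra hbS
        exact hau (h2 b (hb.resolve_left hbS) (fun h => hbS (h ▸ hu)) a ha hab.symm)
      exact ⟨hbS, hab, hψS b hbS ▸ hc⟩
    · rintro ⟨hb, hab, hc⟩
      exact ⟨Or.inl hb, hab, (hψS b hb).trans hc⟩
  have cB : ∀ a ∈ B, a ≠ u → ∀ i, cnt G (S ∪ B) ψ a i = cnt G B ψ a i := by
    intro a ha hau i
    unfold cnt
    congr 1
    ext b
    simp only [Set.mem_ofPred_eq, Set.mem_union]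
    constructor
    · rintro ⟨hb | hb, hab, hc⟩
      · exact ⟨(h2 a ha hau b hb hab) ▸ huB, hab, hc⟩
      · exact ⟨hb, hab, hc⟩
    · rintro ⟨hb, hab, hc⟩
      exact ⟨Or.inr hb, hab, hc⟩
  have cu : ∀ i, cnt G (S ∪ B) ψ u i = cnt G S φ u i + cnt G B ψ u i := by
    intro i
    unfold cnt
    rw [← Set.ncard_union_eq]
    · congr 1
      ext b
      simp only [Set.mem_ofPred_eq, Set.mem_union]
      constructor
      · rintro ⟨hb | hb, hab, hc⟩
        · exact Or.inl ⟨hb, hab, hψS b hb ▸ hc⟩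
        · exact Or.inr ⟨hb, hab, hc⟩
      · rintro (⟨hb, hab, hc⟩ | ⟨hb, hab, hc⟩)
        · exact ⟨Or.inl hb, hab, (hψS b hb).trans hc⟩
        · exact ⟨Or.inr hb, hab, hc⟩
    · rw [Set.disjoint_left]
      rintro b ⟨hb, hab, _⟩ ⟨hb', _, _⟩
      exact h1 b hb' hab.ne' hb
  have eu : ∀ i, Even (cnt G B ψ u i) := by
    intro i
    rw [← hg0, cnt_block hg hr hadj ψ (φ u) hψg 0 i]
    exact pat_even _ _
  refine ⟨Or.inl hv, h3, ψ, ?_, ?_, ?_⟩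
  · have pB : ∀ a ∈ B, ∀ b ∈ B, G.Adj a b → ψ a ≠ ψ b := by
      intro a ha b hb hab
      rw [← hr] at ha hb
      obtain ⟨i, rfl⟩ := ha
      obtain ⟨j, rfl⟩ := hb
      rw [hψg, hψg]
      exact pat_proper _ _ _ ((hadj _ _).1 hab)
    have pSB : ∀ a ∈ S, ∀ b ∈ B, G.Adj a b → ψ a ≠ ψ b := by
      intro a ha b hb hab
      by_cases hbu : b = u
      · have hbS : b ∈ S := hbu ▸ hu
        rw [hψS a ha, hψS b hbS]
        exact hprop a ha b hbS hab
      · exact pB a (h2 b hb hbu a ha hab.symm ▸ huB) b hb hab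
    rintro a (ha | ha) b (hb | hb) hab
    · rw [hψS a ha, hψS b hb]
      exact hprop a ha b hb hab
    · exact pSB a ha b hb hab
    · exact (pSB b hb a ha hab.symm).symm
    · exact pB a ha b hb hab
  · intro a ha hav
    by_cases hau : a = u
    · subst hau
      obtain ⟨i, hi⟩ := hodd a hu hav
      exact ⟨i, by rw [cu]; exact hi.add_even (eu i)⟩
    · rcases ha with ha | ha
      · obtain ⟨i, hi⟩ := hodd a ha hav
        exact ⟨i, by rw [cS a ha hau]; exact hi⟩
      · obtain ⟨j, rfl⟩ : a ∈ Set.range g := hr ▸ ha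
        have hj : j ≠ 0 := fun h => hau (by rw [h, hg0])
        obtain ⟨i, hi⟩ := pat_odd (φ u) j hj
        exact ⟨i, by rw [cB _ ha hau, cnt_block hg hr hadj ψ (φ u) hψg j i]; exact hi⟩
  · intro i
    by_cases hvu : v = u
    · rw [hvu, cu, ← hvu]
      exact (heven i).add (hvu ▸ eu i)
    · rw [cS v hv hvu]
      exact heven i

end C5Aux

open C5Aux

theorem c5_block_graph_almost_odd4colorable {V : Type*} [Fintype V]
    (G : SimpleGraph V) (hconn : G.Connected)
    (hblocks : ∀ S : Set V, IsBlock G S → IsC5Block G S) (v : V) :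
    ∃ φ : V → Fin 4, IsProper4 G φ ∧
      (∀ u : V, u ≠ v → OddAt G φ u) ∧ EvenAt G φ v := by
  obtain ⟨S, -, hS⟩ := (Set.toFinite {T : Set V | Good G v T}).exists_le_maximal (good_base G v)
  have hSg : Good G v S := hS.1
  have huniv : ∀ w, w ∈ S := by
    by_contra hne
    push Not at hne
    obtain ⟨w, hw⟩ := hne
    obtain ⟨p⟩ := hconn.preconnected w v
    obtain ⟨c, s, q, hq, hcs, hs, -⟩ := first_entry S p hw hSg.1
    have hc : c ∉ S := hq c q.end_mem_support
    obtain ⟨B, hB, hsB, hcB⟩ := exists_block hcs.symm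
    have h := good_step hSg hB (hblocks B hB) hs hc hcs.symm hsB hcB
    exact hc (hS.2 h Set.subset_union_left (Or.inr hcB))
  obtain ⟨-, -, φ, h1, h2, h3⟩ := hSg
  have hc : ∀ a i, cnt G S φ a i = nbrCount G φ a i := by
    intro a i
    unfold cnt nbrCount
    congr 1
    ext b
    simp [huniv b]
  refine ⟨φ, fun a b hab => h1 a (huniv a) b (huniv b) hab, ?_, ?_⟩
  · intro a ha
    obtain ⟨i, hi⟩ := h2 a (huniv a) ha
    exact ⟨i, hc a i ▸ hi⟩
  · have h4 : ∀ x : Fin 4, x + 1 ≠ x := by decide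
    exact ⟨φ v + 1, h4 _, hc v _ ▸ h3 _⟩
end

section
/- Every connected outerplanar graph containing at least one block that is not isomorphic to C5 admits an odd 4-coloring; conversely, a connected outerplanar graph all of whose blocks are isomorphic to C5 admits no odd 4-coloring. Hence a connected outerplanar graph G is odd 4-colorable if and only if G has a block not isomorphic to C5. -/
open SimpleGraph

/-- Outerplanarity via one-page book embeddings: the vertices can be linearly
ordered so that no two edges cross (edges `ab`, `cd` cross if `a < c < b < d`). -/
def IsOuterplanar {V : Type*} (G : SimpleGraph V) : Prop :=
  ∃ f : V → ℕ, Function.Injective f ∧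
    ∀ a b c d : V, G.Adj a b → G.Adj c d →
      ¬ (f a < f c ∧ f c < f b ∧ f b < f d)


/-! ## Part 1: the finite computation -/

namespace OddFour

def edgeT : List Nat := [545]
def pathT2 : List Nat := [1060]
def pathT3 : List Nat := [532, 1064]
def pathT4 : List Nat := [532, 545, 548, 1057]
def typesE : List (List Nat) :=
  [[44, 1580, 3104, 3109, 3116],
   [1069, 3620, 3629],
   [36, 45, 1576, 1581],
   [1056, 1065, 1068, 3621, 3628],
   [1572, 1581],
   [1061, 3621],
   [1056, 1065, 3616, 3621],
   [1577],
   [32, 37, 1568],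
   [1573],
   [37, 3109],
   [1060, 3620],
   [1065, 1068, 3616, 3621, 3628],
   [549, 1065],
   [544, 549, 1056, 1061],
   [557, 1064, 1069, 3629],
   [1568, 1580],
   [1064, 3617, 3620],
   [1569, 1576],
   [548],
   [544, 556, 1056, 1061, 1068, 3616, 3628],
   [1060, 1069, 3629],
   [1576, 1581, 3108, 3117],
   [33, 36, 45, 1572, 3105, 3108, 3117],
   [33, 36, 1569, 1572]]
def typesN : List (List Nat) :=
  [[1057, 1064],
   [1562, 1573, 1580, 3109],
   [1554, 1572, 3108],
   [534, 3606, 549, 1065, 1068, 3621, 3628],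
   [534, 1061, 1068],
   [542, 3602, 3614, 557, 1069, 3617, 3620, 3629],
   [1554, 1566, 1569, 1576, 1581, 3108, 3117],
   [532, 3602, 548, 3620],
   [1554, 1560, 1569, 1576, 3105, 3108],
   [22, 37],
   [18, 1554, 33, 36, 1569, 1572],
   [528, 534, 544, 549, 1056, 1061],
   [530, 1060],
   [1552, 1562, 1577, 3104, 3109],
   [528, 540, 1056, 1065],
   [18, 1560, 36, 1576],
   [1562, 1580, 3109, 3116],
   [532, 542, 1057, 1069],
   [532, 548, 1064],
   [528, 534, 540, 3600, 3606, 544, 549, 556, 1061, 3616, 3621, 3628],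
   [534, 540, 549, 556, 1065, 1068],
   [22, 1558, 1562, 44, 1577, 1580, 3116],
   [18, 30, 1554, 1560, 1566, 33, 45, 1569, 1572, 1581, 3105, 3117],
   [1558, 1573, 1580, 3116],
   [1558, 1573, 3109, 3116],
   [532, 542, 1064, 1069],
   [532, 3602, 1064, 3620],
   [540, 3606, 556, 1065, 1068, 3621, 3628],
   [1560, 1566, 1576, 1581, 3105, 3108, 3117]]

/-- Action of the six permutations fixing `0` on 4-bit masks, as packed tables. -/
def perm0 : List Nat :=
  [18364758544493064720, 18364683486789906960, 18355225778678027280,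
   18355113192123290640, 18336085189344794640, 18336047660493215760]

/-- Action of the six permutations mapping `0` to `1` on 4-bit masks, as packed tables. -/
def perm1 : List Nat :=
  [18297203519274627360, 18297128461571469600, 18282904370552071200,
   18282773019571545120, 18263763781218838560, 18263707487941470240]

/-- Apply a packed permutation table to a mask. -/
def pm (t m : Nat) : Nat := Nat.mod (Nat.shiftRight t (Nat.mul 4 m)) 16

/-- Components of a state code `256 * u + 16 * y + w`. -/
def cu (s : Nat) : Nat := Nat.mod (Nat.div s 256) 16
def cy (s : Nat) : Nat := Nat.mod (Nat.div s 16) 16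
def cw (s : Nat) : Nat := Nat.mod s 16

/-- Bitwise or of `g x` over a list. -/
def orL (l : List Nat) (g : Nat → Nat) : Nat :=
  List.rec 0 (fun x _ ih => Nat.lor (g x) ih) l

def mtab (Q : List Nat) : Nat :=
  orL [0, 1, 4, 5, 8, 9, 12, 13] fun v =>
    orL Q fun q => orL perm1 fun t =>
      bif Nat.beq (pm t (cu q)) v then 0
      else Nat.shiftLeft 1 (Nat.add (Nat.mul 256 v) (Nat.add (Nat.mul 16 (pm t (cy q))) (pm t (cw q))))

/-- Set of states of a series composition. -/
def ser (P : List Nat) (M : Nat) : Nat :=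
  orL P fun p =>
    bif Nat.beq (cy p) 2 then
      Nat.shiftLeft (Nat.mod (Nat.shiftRight M (Nat.mul 256 (cw p))) (Nat.pow 2 256)) (Nat.mul 256 (cu p))
    else 0

/-- Orbit of a state under the permutations fixing `0`. -/
def orb (r : Nat) : Nat :=
  orL perm0 fun t =>
    Nat.shiftLeft 1 (Nat.add (Nat.mul 256 (pm t (cu r))) (Nat.add (Nat.mul 16 (pm t (cy r))) (pm t (cw r))))

/-- All states of `r` occur, up to symmetry, in the set `R`. -/
def sub (r : List Nat) (R : Nat) : Bool :=
  List.rec true (fun x _ ih => bif Nat.beq (Nat.land (orb x) R) 0 then false else ih) r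

def anySub (ts : List (List Nat)) (R : Nat) : Bool :=
  List.rec false (fun x _ ih => bif sub x R then true else ih) ts

/-- Evaluate the argument before continuing. -/
def force (n : Nat) (k : Nat → Bool) : Bool :=
  Nat.rec (k 0) (fun m _ => k (Nat.succ m)) n

def allL {α : Type} (l : List α) (g : α → Bool) : Bool :=
  List.rec true (fun x _ ih => bif g x then ih else false) l

def closeM (Q : List Nat) : Nat :=
  orL Q fun q => bif Nat.beq (cy q) 1 then 0 else
    Nat.shiftLeft 1 (Nat.add (Nat.mul 256 (Nat.xor (cu q) (cy q)))
      (Nat.add (Nat.mul 16 (cy q)) (Nat.xor (cw q) 1)))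

def checkSer (P Q : List Nat) (ts : List (List Nat)) : Bool :=
  force (mtab Q) fun M => force (ser P M) fun R => anySub ts R

def checkSerAll (Ps Qs : List (List Nat)) : Bool :=
  allL Qs fun Q => force (mtab Q) fun M => allL Ps fun P => force (ser P M) fun R => anySub typesN R

def checkClose (Q : List Nat) : Bool := force (closeM Q) fun R => anySub typesE R

/-- Acceptance: all vertices odd. -/
def accO (Q : List Nat) : Bool :=
  Q.any fun q => !(Nat.beq (cy q) 1) && (!(Nat.beq (cu q) (cy q)) && !(Nat.beq (cw q) 1))

/-- Acceptance: left end even, all others odd. -/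
def accE (Q : List Nat) : Bool :=
  Q.any fun q => !(Nat.beq (cy q) 1) && (!(Nat.beq (Nat.land (Nat.xor (cu q) (cy q)) 14) 14) && !(Nat.beq (cw q) 1))

theorem check1 : checkSerAll typesE (edgeT :: pathT2 :: pathT3 :: pathT4 :: typesE ++ typesN) = true := by
  decide +kernel
theorem check2 : checkSerAll [edgeT] (pathT4 :: typesE ++ typesN) = true := by
  decide +kernel
theorem check3 : (checkSer edgeT edgeT [pathT2] && checkSer edgeT pathT2 [pathT3]
    && checkSer edgeT pathT3 [pathT4]) = true := by
  decide +kernel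
theorem check4 : ((pathT2 :: pathT3 :: pathT4 :: typesN).all checkClose) = true := by
  decide +kernel
theorem check5 : ((pathT2 :: pathT3 :: typesN).all accO) = true := by decide +kernel
theorem check6 : ((pathT2 :: pathT3 :: pathT4 :: typesN).all accE) = true := by decide +kernel

/-! ## Part 2: parity vectors, gluing, realizable states -/

set_option linter.unusedSectionVars false

section parity
variable {V : Type*} [Fintype V]

open Classical in
/-- Parity vector of the colors in the neighborhood of `u`. -/
noncomputable def par (H : SimpleGraph V) (φ : V → Fin 4) (u : V) : Fin 4 → ZMod 2 :=
  ∑ w, if H.Adj u w then Pi.single (φ w) 1 else 0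

theorem par_sup {H1 H2 : SimpleGraph V} (h : ∀ u w, H1.Adj u w → ¬ H2.Adj u w)
    (φ : V → Fin 4) (u : V) : par (H1 ⊔ H2) φ u = par H1 φ u + par H2 φ u := by
  classical
  unfold par
  rw [← Finset.sum_add_distrib]
  refine Finset.sum_congr rfl fun w _ => ?_
  have := h u w
  by_cases h1 : H1.Adj u w <;> by_cases h2 : H2.Adj u w <;> simp_all

theorem par_congr {H : SimpleGraph V} {φ ψ : V → Fin 4} {u : V}
    (h : ∀ w, H.Adj u w → φ w = ψ w) : par H φ u = par H ψ u := by
  classical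
  unfold par
  refine Finset.sum_congr rfl fun w _ => ?_
  split_ifs with h1
  · rw [h w h1]
  · rfl

theorem par_zero {H : SimpleGraph V} {φ : V → Fin 4} {u : V}
    (h : ∀ w, ¬ H.Adj u w) : par H φ u = 0 := by
  classical
  unfold par
  exact Finset.sum_eq_zero fun w _ => by simp [h w]

theorem par_apply (H : SimpleGraph V) (φ : V → Fin 4) (u : V) (i : Fin 4) :
    par H φ u i = ((nbrCount H φ u i : ℕ) : ZMod 2) := by
  classical
  unfold par nbrCount
  rw [Finset.sum_apply, Set.ncard_eq_toFinset_card', Finset.card_eq_sum_ones, Nat.cast_sum]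
  rw [show ({w | w ∈ H.neighborSet u ∧ φ w = i} : Set V).toFinset
      = Finset.univ.filter (fun w => H.Adj u w ∧ φ w = i) by ext; simp]
  rw [Finset.sum_filter]
  refine Finset.sum_congr rfl fun w _ => ?_
  by_cases h1 : H.Adj u w
  · by_cases h2 : φ w = i
    · subst h2; simp [h1]
    · simp [h1, h2, Ne.symm h2]
  · simp [h1]

theorem oddAt_iff (H : SimpleGraph V) (φ : V → Fin 4) (u : V) :
    OddAt H φ u ↔ par H φ u ≠ 0 := by
  unfold OddAt
  rw [Function.ne_iff]
  refine exists_congr fun i => ?_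
  rw [par_apply, Pi.zero_apply, Ne, ZMod.natCast_eq_zero_iff_even, Nat.not_even_iff_odd]

theorem par_perm (H : SimpleGraph V) (φ : V → Fin 4) (σ : Equiv.Perm (Fin 4)) (u : V) :
    par H (fun w => σ (φ w)) u = par H φ u ∘ σ.symm := by
  classical
  funext i
  simp only [par, Function.comp, Finset.sum_apply]
  refine Finset.sum_congr rfl fun w _ => ?_
  split_ifs
  · simp only [Pi.single_apply]
    congr 1
    rw [eq_iff_iff, Equiv.symm_apply_eq]
  · rfl

theorem par_self {H : SimpleGraph V} {φ : V → Fin 4} (h : IsProper4 H φ) (u : V) :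
    par H φ u (φ u) = 0 := by
  classical
  simp only [par, Finset.sum_apply]
  refine Finset.sum_eq_zero fun w _ => ?_
  split_ifs with h1
  · simp [h h1]
  · rfl

theorem par_pair {H : SimpleGraph V} {φ : V → Fin 4} {u x y : V} (hxy : x ≠ y)
    (h : ∀ w, H.Adj u w ↔ w = x ∨ w = y) :
    par H φ u = Pi.single (φ x) 1 + Pi.single (φ y) 1 := by
  classical
  unfold par
  rw [← Finset.sum_filter,
    show Finset.univ.filter (fun w => H.Adj u w) = {x, y} by ext; simp [h]]
  rw [Finset.sum_pair hxy]

theorem par_single {H : SimpleGraph V} {φ : V → Fin 4} {u x : V}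
    (h : ∀ w, H.Adj u w ↔ w = x) :
    par H φ u = Pi.single (φ x) 1 := by
  classical
  unfold par
  rw [← Finset.sum_filter,
    show Finset.univ.filter (fun w => H.Adj u w) = {x} by ext; simp [h]]
  rw [Finset.sum_singleton]

theorem par_edge_left {a b : V} (hab : a ≠ b) (φ : V → Fin 4) :
    par (edge a b) φ a = Pi.single (φ b) 1 :=
  par_single fun w => by rw [edge_adj]; grind

theorem par_edge_right {a b : V} (hab : a ≠ b) (φ : V → Fin 4) :
    par (edge a b) φ b = Pi.single (φ a) 1 :=
  par_single fun w => by rw [edge_adj]; grind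

theorem par_edge_other {a b u : V} (ha : u ≠ a) (hb : u ≠ b) (φ : V → Fin 4) :
    par (edge a b) φ u = 0 :=
  par_zero fun w => by rw [edge_adj]; grind

/-- All edges of `H` lie inside `X`. -/
def Supp (H : SimpleGraph V) (X : Set V) : Prop := ∀ u w, H.Adj u w → u ∈ X

theorem Supp.right {H : SimpleGraph V} {X : Set V} (h : Supp H X) {u w : V} (a : H.Adj u w) :
    w ∈ X := h w u a.symm

theorem glue {H1 H2 : SimpleGraph V} {X1 X2 : Set V} {z : V} (s1 : Supp H1 X1) (s2 : Supp H2 X2)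
    (hX : ∀ u, u ∈ X1 → u ∈ X2 → u = z)
    {φ1 φ2 : V → Fin 4} (p1 : IsProper4 H1 φ1) (p2 : IsProper4 H2 φ2) (hz : φ1 z = φ2 z) :
    ∃ φ : V → Fin 4, IsProper4 (H1 ⊔ H2) φ ∧ (∀ u ∈ X1, φ u = φ1 u) ∧ (∀ u ∈ X2, φ u = φ2 u) ∧
      (∀ u ∈ X1, u ≠ z → par (H1 ⊔ H2) φ u = par H1 φ1 u) ∧
      (∀ u ∈ X2, u ≠ z → par (H1 ⊔ H2) φ u = par H2 φ2 u) ∧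
      par (H1 ⊔ H2) φ z = par H1 φ1 z + par H2 φ2 z := by
  classical
  have e1 : ∀ u ∈ X1, (if u ∈ X1 then φ1 u else φ2 u) = φ1 u := fun u hu => if_pos hu
  have e2 : ∀ u ∈ X2, (if u ∈ X1 then φ1 u else φ2 u) = φ2 u := by
    intro u hu
    split_ifs with h
    · rw [hX u h hu, hz]
    · rfl
  have hdis : ∀ u w, H1.Adj u w → ¬ H2.Adj u w := by
    intro u w h1 h2
    have a := hX u (s1 _ _ h1) (s2 _ _ h2)
    have b := hX w (s1.right h1) (s2.right h2)
    exact h1.ne (a.trans b.symm)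
  have c1 : ∀ u, par H1 (fun u => if u ∈ X1 then φ1 u else φ2 u) u = par H1 φ1 u :=
    fun u => par_congr fun w hw => e1 w (s1.right hw)
  have c2 : ∀ u, par H2 (fun u => if u ∈ X1 then φ1 u else φ2 u) u = par H2 φ2 u :=
    fun u => par_congr fun w hw => e2 w (s2.right hw)
  refine ⟨fun u => if u ∈ X1 then φ1 u else φ2 u, ?_, e1, e2, ?_, ?_, ?_⟩
  · intro u w h
    rcases h with h | h
    · simp only [e1 u (s1 _ _ h), e1 w (s1.right h)]; exact p1 h
    · simp only [e2 u (s2 _ _ h), e2 w (s2.right h)]; exact p2 h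
  · intro u hu huz
    rw [par_sup hdis, c1, c2, par_zero (H := H2), add_zero]
    intro w hw; exact huz (hX u hu (s2 _ _ hw))
  · intro u hu huz
    rw [par_sup hdis, c1, c2, par_zero (H := H1), zero_add]
    intro w hw; exact huz (hX u (s1 _ _ hw) hu)
  · rw [par_sup hdis, c1, c2]

theorem proper_perm {H : SimpleGraph V} {φ : V → Fin 4} (h : IsProper4 H φ)
    (σ : Equiv.Perm (Fin 4)) : IsProper4 H (fun w => σ (φ w)) :=
  fun _ _ a e => h a (σ.injective e)

/-- Decode a mask to a parity vector. -/
def dec (m : ℕ) : Fin 4 → ZMod 2 := fun i => if m.testBit i then 1 else 0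

theorem dec_xor (a b : ℕ) : dec (Nat.xor a b) = dec a + dec b := by
  funext i
  have : (Nat.xor a b).testBit i = (a.testBit i ^^ b.testBit i) := Nat.testBit_xor ..
  simp only [dec, Pi.add_apply, this]
  cases a.testBit i <;> cases b.testBit i <;> decide

theorem dec_inj : ∀ a < 16, ∀ b < 16, dec a = dec b → a = b := by decide +kernel

theorem perm0_spec : ∀ t ∈ perm0, ∃ σ : Equiv.Perm (Fin 4), σ 0 = 0 ∧
    ∀ m < 16, dec (pm t m) = dec m ∘ σ.symm := by decide +kernel

theorem perm1_spec : ∀ t ∈ perm1, ∃ σ : Equiv.Perm (Fin 4), σ 0 = 1 ∧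
    ∀ m < 16, dec (pm t m) = dec m ∘ σ.symm := by decide +kernel

theorem dec_single : ∀ i : Fin 4, ∀ m < 16, Pi.single i 1 = dec m → m = 2 ^ (i : ℕ) := by
  decide +kernel

theorem pm_lt (t m : ℕ) : pm t m < 16 := Nat.mod_lt _ (by decide)
theorem cu_lt (m : ℕ) : cu m < 16 := Nat.mod_lt _ (by decide)
theorem cy_lt (m : ℕ) : cy m < 16 := Nat.mod_lt _ (by decide)
theorem cw_lt (m : ℕ) : cw m < 16 := Nat.mod_lt _ (by decide)

/-- Realizability of the state with components `u, y, w`. -/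
def Re3 (H : SimpleGraph V) (X : Set V) (a b : V) (u y w : ℕ) : Prop :=
  ∃ φ : V → Fin 4, IsProper4 H φ ∧ (∀ v ∈ X, v ≠ a → v ≠ b → par H φ v ≠ 0) ∧ φ a = 0 ∧
    Pi.single (φ b) 1 = dec y ∧ par H φ a = dec u ∧ par H φ b = dec w

def Re (H : SimpleGraph V) (X : Set V) (a b : V) (s : ℕ) : Prop :=
  Re3 H X a b (cu s) (cy s) (cw s)

/-- All the listed states are realizable. -/
def Has (H : SimpleGraph V) (X : Set V) (a b : V) (P : List ℕ) : Prop := ∀ s ∈ P, Re H X a b s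

def Snd (R : ℕ → Prop) (m : ℕ) : Prop := ∀ i, m.testBit i = true → R i

theorem Snd.zero (R : ℕ → Prop) : Snd R 0 := fun i h => by simp at h

theorem Snd.bit {R : ℕ → Prop} {j : ℕ} (h : R j) : Snd R (Nat.shiftLeft 1 j) := fun i hi => by
  have : (1 <<< j).testBit i = true := hi
  rw [Nat.one_shiftLeft, Nat.testBit_two_pow] at this
  simp at this
  exact this ▸ h

theorem Snd.orL {R : ℕ → Prop} {l : List ℕ} {g : ℕ → ℕ} (h : ∀ x ∈ l, Snd R (g x)) :
    Snd R (orL l g) := by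
  induction l with
  | nil => exact Snd.zero R
  | cons x l ih =>
    intro i hi
    have hi' : (g x ||| OddFour.orL l g).testBit i = true := hi
    rw [Nat.testBit_or, Bool.or_eq_true] at hi'
    rcases hi' with h1 | h1
    · exact h x (by simp) i h1
    · exact ih (fun y hy => h y (by simp [hy])) i h1

theorem orb_sound {H : SimpleGraph V} {X : Set V} {a b : V} {R r : ℕ}
    (hR : Snd (Re H X a b) R) (h : Nat.beq (Nat.land (orb r) R) 0 = false) : Re H X a b r := by
  have h0 : orb r &&& R ≠ 0 := fun e => by
    rw [show Nat.land (orb r) R = 0 from e] at h; simp at h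
  obtain ⟨i, hi⟩ := Nat.exists_testBit_of_ne_zero h0
  rw [Nat.testBit_and, Bool.and_eq_true] at hi
  have key : Snd (fun i => Re H X a b i → Re H X a b r) (orb r) := by
    refine Snd.orL fun t ht => Snd.bit ?_
    intro hre
    obtain ⟨σ, h0, hσ⟩ := perm0_spec t ht
    have l1 := pm_lt t (cu r)
    have l2 := pm_lt t (cy r)
    have l3 := pm_lt t (cw r)
    set c := Nat.add (Nat.mul 256 (pm t (cu r)))
      (Nat.add (Nat.mul 16 (pm t (cy r))) (pm t (cw r))) with hc
    have hc' : c = 256 * pm t (cu r) + (16 * pm t (cy r) + pm t (cw r)) := hc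
    have d1 : cu c = pm t (cu r) := by show c / 256 % 16 = _; omega
    have d2 : cy c = pm t (cy r) := by show c / 16 % 16 = _; omega
    have d3 : cw c = pm t (cw r) := by show c % 16 = _; omega
    obtain ⟨φ, q1, q2, q3, q4, q5, q6⟩ := hre
    rw [d1, hσ _ (cu_lt r)] at q5
    rw [d2, hσ _ (cy_lt r)] at q4
    rw [d3, hσ _ (cw_lt r)] at q6
    refine ⟨fun w => σ.symm (φ w), proper_perm q1 _, ?_, ?_, ?_, ?_, ?_⟩
    · intro v hv ha hb e
      rw [par_perm] at e
      refine q2 v hv ha hb ?_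
      funext i
      have := congrFun e (σ.symm i)
      simpa using this
    · show σ.symm (φ a) = 0
      rw [q3, Equiv.symm_apply_eq, h0]
    · funext i
      have := congrFun q4 (σ i)
      simp only [Function.comp, Equiv.symm_apply_apply] at this
      rw [← this]
      simp only [Pi.single_apply, Equiv.eq_symm_apply]
    · rw [par_perm, q5]; funext i; simp
    · rw [par_perm, q6]; funext i; simp
  exact key i hi.1 (hR i hi.2)

theorem sub_sound {H : SimpleGraph V} {X : Set V} {a b : V} {R : ℕ} {P : List ℕ}
    (hR : Snd (Re H X a b) R) (h : sub P R = true) : Has H X a b P := by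
  induction P with
  | nil => intro s hs; simp at hs
  | cons x l ih =>
    have h' : (bif Nat.beq (Nat.land (orb x) R) 0 then false else sub l R) = true := h
    cases hb : Nat.beq (Nat.land (orb x) R) 0 with
    | true => rw [hb] at h'; simp at h'
    | false =>
      rw [hb] at h'
      intro s hs
      rcases List.mem_cons.1 hs with rfl | hs
      · exact orb_sound hR hb
      · exact ih h' s hs

theorem anySub_sound {H : SimpleGraph V} {X : Set V} {a b : V} {R : ℕ} {ts : List (List ℕ)}
    (hR : Snd (Re H X a b) R) (h : anySub ts R = true) : ∃ P ∈ ts, Has H X a b P := by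
  induction ts with
  | nil => exact absurd h Bool.false_ne_true
  | cons x l ih =>
    have h' : (bif sub x R then true else anySub l R) = true := h
    cases hb : sub x R with
    | true => exact ⟨x, by simp, sub_sound hR hb⟩
    | false =>
      rw [hb] at h'
      obtain ⟨P, hP, h2⟩ := ih h'
      exact ⟨P, by simp [hP], h2⟩

theorem force_eq (n : ℕ) (k : ℕ → Bool) : force n k = k n := by
  cases n <;> rfl

theorem allL_iff {α : Type} (l : List α) (g : α → Bool) : allL l g = true ↔ ∀ x ∈ l, g x = true := by
  induction l with
  | nil => simp [allL]
  | cons x l ih =>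
    have : allL (x :: l) g = bif g x then allL l g else false := rfl
    rw [this]
    cases hg : g x <;> simp [hg, ih]

theorem xor_lt16 (q : ℕ) : Nat.xor (cu q) (cy q) < 16 :=
  Nat.xor_lt_two_pow (n := 4) (cu_lt q) (cy_lt q)

theorem close_one {H : SimpleGraph V} {X : Set V} {a b : V} (hab : a ≠ b)
    (hn : ¬ H.Adj a b) {q : ℕ} (hQ : Re H X a b q) (hb : Nat.beq (cy q) 1 = false) :
    Re3 (H ⊔ edge a b) X a b (Nat.xor (cu q) (cy q)) (cy q) (Nat.xor (cw q) 1) := by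
  obtain ⟨φ, q1, q2, q3, q4, q5, q6⟩ := hQ
  have hne : cy q ≠ 1 := fun e => by simp [e] at hb
  have hφ : φ a ≠ φ b := by
    intro e
    apply hne
    have := dec_single (φ b) _ (cy_lt q) q4
    rw [this, ← e, q3]; rfl
  have hdis : ∀ u w, H.Adj u w → ¬ (edge a b).Adj u w := by
    intro u w h1 h2
    rw [edge_adj] at h2
    rcases h2.1 with ⟨rfl, rfl⟩ | ⟨rfl, rfl⟩
    · exact hn h1
    · exact hn h1.symm
  refine ⟨φ, ?_, ?_, q3, q4, ?_, ?_⟩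
  · rintro u w (h | h)
    · exact q1 h
    · rw [edge_adj] at h
      rcases h.1 with ⟨rfl, rfl⟩ | ⟨rfl, rfl⟩
      · exact hφ
      · exact hφ.symm
  · intro v hv ha hb
    rw [par_sup hdis, par_edge_other ha hb, add_zero]
    exact q2 v hv ha hb
  · rw [par_sup hdis, par_edge_left hab, dec_xor, q4, q5]
  · rw [par_sup hdis, par_edge_right hab, dec_xor, q6, q3]
    congr 1; funext i; revert i; decide

theorem close_sound {H : SimpleGraph V} {X : Set V} {a b : V} (hab : a ≠ b)
    (hn : ¬ H.Adj a b) {Q : List ℕ} (hQ : Has H X a b Q) :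
    Snd (Re (H ⊔ edge a b) X a b) (closeM Q) := by
  refine Snd.orL fun q hq => ?_
  cases hb : Nat.beq (cy q) 1 with
  | true => exact Snd.zero _
  | false =>
    refine Snd.bit ?_
    have l2 := cy_lt q
    have x1 := xor_lt16 q
    have x2 : Nat.xor (cw q) 1 < 16 := Nat.xor_lt_two_pow (n := 4) (cw_lt q) (by decide)
    set c := Nat.add (Nat.mul 256 (Nat.xor (cu q) (cy q)))
      (Nat.add (Nat.mul 16 (cy q)) (Nat.xor (cw q) 1)) with hc
    have hc' : c = 256 * Nat.xor (cu q) (cy q) + (16 * cy q + Nat.xor (cw q) 1) := hc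
    have d1 : cu c = Nat.xor (cu q) (cy q) := by show c / 256 % 16 = _; omega
    have d2 : cy c = cy q := by show c / 16 % 16 = _; omega
    have d3 : cw c = Nat.xor (cw q) 1 := by show c % 16 = _; omega
    unfold Re
    rw [d1, d2, d3]
    exact close_one hab hn (hQ q hq) hb

theorem ser_sound {H1 H2 : SimpleGraph V} {X1 X2 : Set V} {a b z : V} (s1 : Supp H1 X1)
    (s2 : Supp H2 X2) (hX : ∀ u, u ∈ X1 → u ∈ X2 → u = z) (ha : a ∈ X1) (haz : a ≠ z)
    (hb : b ∈ X2) (hbz : b ≠ z) {P Q : List ℕ} (hP : Has H1 X1 a z P)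
    (hQ : Has H2 X2 z b Q) :
    Snd (Re (H1 ⊔ H2) (X1 ∪ X2) a b) (ser P (mtab Q)) := by
  refine Snd.orL fun p hp => ?_
  cases hb2 : Nat.beq (cy p) 2 with
  | false => exact Snd.zero _
  | true =>
    have hy : cy p = 2 := Nat.eq_of_beq_eq_true hb2
    obtain ⟨φ, q1, q2, q3, q4, q5, q6⟩ := hP p hp
    have hφz : φ z = 1 := by
      have := dec_single (φ z) _ (cy_lt p) q4
      rw [hy] at this
      revert this; generalize φ z = i; revert i; decide
    have lu := cu_lt p
    -- meaning of the bits of the table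
    have key : Snd (fun i => ∀ v j, i = 256 * v + j → j < 256 → v < 16 →
        ∃ ψ : V → Fin 4, IsProper4 H2 ψ ∧ (∀ x ∈ X2, x ≠ z → x ≠ b → par H2 ψ x ≠ 0) ∧
        ψ z = 1 ∧ par H2 ψ z ≠ dec v ∧ Pi.single (ψ b) 1 = dec (j / 16) ∧
          par H2 ψ b = dec (j % 16)) (mtab Q) := by
      refine Snd.orL fun v _ => Snd.orL fun q hq => Snd.orL fun t ht => ?_
      cases hv : Nat.beq (pm t (cu q)) v with
      | true => exact Snd.zero _
      | false =>
        have hv' : pm t (cu q) ≠ v := fun e => by simp [e] at hv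
        refine Snd.bit ?_
        intro v' j hj hj2 hv16
        have l2 := pm_lt t (cy q)
        have l3 := pm_lt t (cw q)
        have hj' : 256 * v + (16 * pm t (cy q) + pm t (cw q)) = 256 * v' + j := hj
        have hvv : v' = v := by omega
        subst hvv
        obtain ⟨σ, h0, hσ⟩ := perm1_spec t ht
        obtain ⟨ψ, r1, r2, r3, r4, r5, r6⟩ := hQ q hq
        have e1 : j / 16 = pm t (cy q) := by omega
        have e2 : j % 16 = pm t (cw q) := by omega
        refine ⟨fun w => σ (ψ w), proper_perm r1 _, ?_, ?_, ?_, ?_, ?_⟩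
        · intro x hx hxz hxb e
          rw [par_perm] at e
          refine r2 x hx hxz hxb ?_
          funext i
          have := congrFun e (σ i)
          simpa using this
        · show σ (ψ z) = 1
          rw [r3, h0]
        · rw [par_perm, r5, ← hσ _ (cu_lt q)]
          intro e
          exact hv' (dec_inj _ (pm_lt _ _) _ hv16 e)
        · rw [e1, hσ _ (cy_lt q), ← r4]
          funext i
          simp only [Pi.single_apply, Function.comp, Equiv.symm_apply_eq]
        · rw [par_perm, r6, e2, hσ _ (cw_lt q)]
    intro i hi
    have hi' : (((mtab Q >>> (256 * cw p)) % 2 ^ 256) <<< (256 * cu p)).testBit i = true := hi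
    rw [Nat.testBit_shiftLeft, Nat.testBit_mod_two_pow, Nat.testBit_shiftRight] at hi'
    simp only [Bool.and_eq_true, decide_eq_true_eq] at hi'
    obtain ⟨g1, g2, g3⟩ := hi'
    obtain ⟨ψ, r1, r2, r3, r4, r5, r6⟩ := key _ g3 (cw p) (i - 256 * cu p) rfl g2 (cw_lt p)
    have d1 : cu i = cu p := by show i / 256 % 16 = _; omega
    have d2 : cy i = (i - 256 * cu p) / 16 := by show i / 16 % 16 = _; omega
    have d3 : cw i = (i - 256 * cu p) % 16 := by show i % 16 = _; omega
    obtain ⟨χ, t1, t2, t3, t4, t5, t6⟩ := glue s1 s2 hX q1 r1 (hφz.trans r3.symm)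
    have hz0 : par H1 φ z + par H2 ψ z ≠ 0 := by
      intro e
      apply r4
      rw [← q6]
      have h2 := CharTwo.add_self_eq_zero (R := ZMod 2)
      funext k
      have := congrFun e k
      simp only [Pi.add_apply, Pi.zero_apply] at this
      have h3 := h2 (par H1 φ z k)
      exact add_left_cancel (this.trans h3.symm)
    refine ⟨χ, t1, ?_, ?_, ?_, ?_, ?_⟩
    · intro v hv hva hvb
      by_cases hvz : v = z
      · rw [hvz, t6]; exact hz0
      · rcases hv with hv | hv
        · rw [t4 v hv hvz]; exact q2 v hv hva hvz
        · rw [t5 v hv hvz]; exact r2 v hv hvz hvb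
    · rw [t2 a ha, q3]
    · rw [t3 b hb, r5, d2]
    · rw [t4 a ha haz, q5, d1]
    · rw [t5 b hb hbz, r6, d3]

end parity

/-! ## Part 3: claims about pieces -/

section pieces
variable {V : Type*} [Fintype V]

/-- `H` is a path with `n` edges from `a` to `b` with vertex set `X`. -/
def PathP : ℕ → SimpleGraph V → Set V → V → V → Prop
  | 0, _, _, _, _ => False
  | 1, H, X, a, b => H = edge a b ∧ X = {a, b} ∧ a ≠ b
  | (n + 2), H, X, a, b => ∃ z H2 X2, a ∉ X2 ∧ PathP (n + 1) H2 X2 z b ∧ H = edge a z ⊔ H2 ∧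
      X = insert a X2

def ClaimE (H : SimpleGraph V) (X : Set V) (a b : V) : Prop :=
  (Has H X a b edgeT ∧ PathP 1 H X a b) ∨ ∃ P ∈ typesE, Has H X a b P

def ClaimN (H : SimpleGraph V) (X : Set V) (a b : V) : Prop :=
  (Has H X a b pathT2 ∧ PathP 2 H X a b) ∨ (Has H X a b pathT3 ∧ PathP 3 H X a b) ∨
  (Has H X a b pathT4 ∧ PathP 4 H X a b) ∨ ∃ P ∈ typesN, Has H X a b P

theorem claimE_edge {a b : V} (hab : a ≠ b) : ClaimE (edge a b) {a, b} a b := by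
  refine Or.inl ⟨?_, rfl, rfl, hab⟩
  intro s hs
  simp only [edgeT, List.mem_singleton] at hs
  subst hs
  classical
  refine ⟨fun v => if v = a then 0 else 1, ?_, ?_, ?_, ?_, ?_, ?_⟩
  · intro u w h
    rw [edge_adj] at h
    rcases h.1 with ⟨rfl, rfl⟩ | ⟨rfl, rfl⟩
    · simp [h.2.symm]
    · simp [h.2]
  · intro v hv h1 h2
    rcases hv with hv | hv
    · exact absurd hv h1
    · exact absurd hv h2
  · simp
  · simp only [hab.symm, if_false]; decide +kernel
  · rw [par_edge_left hab]; simp only [hab.symm, if_false]; decide +kernel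
  · rw [par_edge_right hab]; simp only [if_true]; decide +kernel

theorem serAll {H1 H2 : SimpleGraph V} {X1 X2 : Set V} {a b z : V} (s1 : Supp H1 X1)
    (s2 : Supp H2 X2) (hX : ∀ u, u ∈ X1 → u ∈ X2 → u = z) (ha : a ∈ X1) (haz : a ≠ z)
    (hb : b ∈ X2) (hbz : b ≠ z) {P Q : List ℕ} (hP : Has H1 X1 a z P)
    (hQ : Has H2 X2 z b Q) {Ps Qs : List (List ℕ)} (hPs : P ∈ Ps) (hQs : Q ∈ Qs)
    (hc : checkSerAll Ps Qs = true) :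
    ∃ T ∈ typesN, Has (H1 ⊔ H2) (X1 ∪ X2) a b T := by
  have h1 := (allL_iff _ _).1 hc Q hQs
  rw [force_eq] at h1
  have h2 := (allL_iff _ _).1 h1 P hPs
  rw [force_eq] at h2
  exact anySub_sound (ser_sound s1 s2 hX ha haz hb hbz hP hQ) h2

theorem serOne {H1 H2 : SimpleGraph V} {X1 X2 : Set V} {a b z : V} (s1 : Supp H1 X1)
    (s2 : Supp H2 X2) (hX : ∀ u, u ∈ X1 → u ∈ X2 → u = z) (ha : a ∈ X1) (haz : a ≠ z)
    (hb : b ∈ X2) (hbz : b ≠ z) {P Q T : List ℕ} (hP : Has H1 X1 a z P)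
    (hQ : Has H2 X2 z b Q) (hc : checkSer P Q [T] = true) :
    Has (H1 ⊔ H2) (X1 ∪ X2) a b T := by
  unfold checkSer at hc
  rw [force_eq, force_eq] at hc
  obtain ⟨T', hT, h⟩ := anySub_sound (ser_sound s1 s2 hX ha haz hb hbz hP hQ) hc
  rw [List.mem_singleton] at hT
  exact hT ▸ h

theorem pathP_mem {n : ℕ} {H : SimpleGraph V} {X : Set V} {a b : V} (h : PathP n H X a b) :
    a ∈ X ∧ b ∈ X := by
  induction n generalizing H X a with
  | zero => exact h.elim
  | succ n ih =>
    cases n with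
    | zero => obtain ⟨_, rfl, _⟩ := h; simp
    | succ n =>
      obtain ⟨z, H2, X2, h1, h2, h3, rfl⟩ := h
      exact ⟨by simp, by simp [(ih h2).2]⟩

theorem pathP_cons {n : ℕ} {H1 H2 : SimpleGraph V} {X1 X2 : Set V} {a b z : V}
    (hX : ∀ u, u ∈ X1 → u ∈ X2 → u = z) (h1 : PathP 1 H1 X1 a z)
    (h2 : PathP (n + 1) H2 X2 z b) :
    PathP (n + 2) (H1 ⊔ H2) (X1 ∪ X2) a b := by
  obtain ⟨rfl, rfl, haz⟩ := h1
  have hz := (pathP_mem h2).1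
  refine ⟨z, H2, X2, fun h => haz (hX a (by simp) h), h2, rfl, ?_⟩
  ext u; simp only [Set.mem_union, Set.mem_insert_iff, Set.mem_singleton_iff]
  constructor
  · rintro ((h | h) | h)
    · exact Or.inl h
    · exact Or.inr (h ▸ hz)
    · exact Or.inr h
  · rintro (h | h)
    · exact Or.inl (Or.inl h)
    · exact Or.inr h

theorem claim_series {H1 H2 : SimpleGraph V} {X1 X2 : Set V} {a b z : V} (s1 : Supp H1 X1)
    (s2 : Supp H2 X2) (hX : ∀ u, u ∈ X1 → u ∈ X2 → u = z) (ha : a ∈ X1) (haz : a ≠ z)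
    (hb : b ∈ X2) (hbz : b ≠ z) (h1 : ClaimE H1 X1 a z)
    (h2 : ClaimE H2 X2 z b ∨ ClaimN H2 X2 z b) :
    ClaimN (H1 ⊔ H2) (X1 ∪ X2) a b := by
  have c3 := check3
  rw [Bool.and_eq_true, Bool.and_eq_true] at c3
  obtain ⟨⟨c31, c32⟩, c33⟩ := c3
  rcases h1 with ⟨hE, hp⟩ | ⟨P, hP, hE⟩
  · rcases h2 with (⟨h, p⟩ | ⟨Q, hQ, h⟩) | (⟨h, p⟩ | ⟨h, p⟩ | ⟨h, p⟩ | ⟨Q, hQ, h⟩)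
    · exact Or.inl ⟨serOne s1 s2 hX ha haz hb hbz hE h c31, pathP_cons hX hp p⟩
    · exact Or.inr (Or.inr (Or.inr (serAll s1 s2 hX ha haz hb hbz hE h (by simp) (by simp [hQ]) check2)))
    · exact Or.inr (Or.inl ⟨serOne s1 s2 hX ha haz hb hbz hE h c32, pathP_cons hX hp p⟩)
    · exact Or.inr (Or.inr (Or.inl ⟨serOne s1 s2 hX ha haz hb hbz hE h c33, pathP_cons hX hp p⟩))
    · exact Or.inr (Or.inr (Or.inr (serAll s1 s2 hX ha haz hb hbz hE h (by simp) (by simp) check2)))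
    · exact Or.inr (Or.inr (Or.inr (serAll s1 s2 hX ha haz hb hbz hE h (by simp) (by simp [hQ]) check2)))
  · rcases h2 with (⟨h, p⟩ | ⟨Q, hQ, h⟩) | (⟨h, p⟩ | ⟨h, p⟩ | ⟨h, p⟩ | ⟨Q, hQ, h⟩) <;>
    exact Or.inr (Or.inr (Or.inr (serAll s1 s2 hX ha haz hb hbz hE h hP (by simp [*]) check1)))

theorem claim_close {H : SimpleGraph V} {X : Set V} {a b : V} (hab : a ≠ b)
    (hn : ¬ H.Adj a b) (h : ClaimN H X a b) : ClaimE (H ⊔ edge a b) X a b := by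
  have key : ∃ Q ∈ (pathT2 :: pathT3 :: pathT4 :: typesN), Has H X a b Q := by
    rcases h with ⟨h, p⟩ | ⟨h, p⟩ | ⟨h, p⟩ | ⟨Q, hQ, h⟩
    · exact ⟨_, by simp, h⟩
    · exact ⟨pathT3, by simp, h⟩
    · exact ⟨pathT4, by simp, h⟩
    · exact ⟨Q, by simp [hQ], h⟩
  obtain ⟨Q, hQ, h⟩ := key
  have hc := List.all_eq_true.1 check4 Q hQ
  unfold checkClose at hc
  rw [force_eq] at hc
  exact Or.inr (anySub_sound (close_sound hab hn h) hc)

theorem mask_aux : ∀ m < 16, (Nat.land m 14).beq 14 = false →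
    ∃ i : Fin 4, i ≠ 0 ∧ dec m i = 0 := by decide +kernel

theorem claim_even {H : SimpleGraph V} {X : Set V} {a b : V} (hab : a ≠ b)
    (hn : ¬ H.Adj a b) (h : ClaimN H X a b) :
    ∃ φ, IsProper4 (H ⊔ edge a b) φ ∧ (∀ v ∈ X, v ≠ a → par (H ⊔ edge a b) φ v ≠ 0) ∧
      ∃ i, i ≠ φ a ∧ par (H ⊔ edge a b) φ a i = 0 := by
  have key : ∃ Q ∈ (pathT2 :: pathT3 :: pathT4 :: typesN), Has H X a b Q := by
    rcases h with ⟨h, p⟩ | ⟨h, p⟩ | ⟨h, p⟩ | ⟨Q, hQ, h⟩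
    · exact ⟨_, by simp, h⟩
    · exact ⟨pathT3, by simp, h⟩
    · exact ⟨pathT4, by simp, h⟩
    · exact ⟨Q, by simp [hQ], h⟩
  obtain ⟨Q, hQ, h⟩ := key
  have hc := List.all_eq_true.1 check6 Q hQ
  unfold accE at hc
  rw [List.any_eq_true] at hc
  obtain ⟨q, hq, hc⟩ := hc
  simp only [Bool.and_eq_true, Bool.not_eq_true'] at hc
  obtain ⟨g1, g2, g3⟩ := hc
  obtain ⟨φ, q1, q2, q3, q4, q5, q6⟩ := close_one hab hn (h q hq) g1
  refine ⟨φ, q1, ?_, ?_⟩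
  · intro v hv hva
    by_cases hvb : v = b
    · rw [hvb, q6]
      intro e
      have := dec_inj _ (Nat.xor_lt_two_pow (n := 4) (cw_lt q) (by decide)) 0 (by decide) (e.trans (by decide))
      have : cw q ^^^ 1 = 0 := this
      rw [Nat.xor_eq_zero_iff] at this
      simp [this] at g3
    · exact q2 v hv hva hvb
  · rw [q5, q3]
    exact mask_aux _ (xor_lt16 q) g2

theorem claim_odd {H : SimpleGraph V} {X : Set V} {a b : V} (hab : a ≠ b)
    (hn : ¬ H.Adj a b) (h : ClaimN H X a b) (h4 : ¬ PathP 4 H X a b) :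
    ∃ φ, IsProper4 (H ⊔ edge a b) φ ∧ (∀ v ∈ X, par (H ⊔ edge a b) φ v ≠ 0) := by
  have key : ∃ Q ∈ (pathT2 :: pathT3 :: typesN), Has H X a b Q := by
    rcases h with ⟨h, p⟩ | ⟨h, p⟩ | ⟨h, p⟩ | ⟨Q, hQ, h⟩
    · exact ⟨_, by simp, h⟩
    · exact ⟨pathT3, by simp, h⟩
    · exact absurd p h4
    · exact ⟨Q, by simp [hQ], h⟩
  obtain ⟨Q, hQ, h⟩ := key
  have hc := List.all_eq_true.1 check5 Q hQ
  unfold accO at hc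
  rw [List.any_eq_true] at hc
  obtain ⟨q, hq, hc⟩ := hc
  simp only [Bool.and_eq_true, Bool.not_eq_true'] at hc
  obtain ⟨g1, g2, g3⟩ := hc
  obtain ⟨φ, q1, q2, q3, q4, q5, q6⟩ := close_one hab hn (h q hq) g1
  refine ⟨φ, q1, ?_⟩
  intro v hv
  by_cases hvb : v = b
  · rw [hvb, q6]
    intro e
    have := dec_inj _ (Nat.xor_lt_two_pow (n := 4) (cw_lt q) (by decide)) 0 (by decide) (e.trans (by decide))
    have : cw q ^^^ 1 = 0 := this
    rw [Nat.xor_eq_zero_iff] at this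
    simp [this] at g3
  by_cases hva : v = a
  · rw [hva, q5]
    intro e
    have := dec_inj _ (xor_lt16 q) 0 (by decide) (e.trans (by decide))
    have : cu q ^^^ cy q = 0 := this
    rw [Nat.xor_eq_zero_iff] at this
    simp [this] at g2
  exact q2 v hv hva hvb

end pieces
/-! ## Part 4: structure of a single block -/

section block
variable {V : Type*}

/-- Combinatorial connectivity of the set `T`. -/
def Conn (G : SimpleGraph V) (T : Set V) : Prop :=
  T.Nonempty ∧ ∀ C : Set V, C ⊆ T → C.Nonempty →
    (∀ u ∈ C, ∀ w ∈ T, G.Adj u w → w ∈ C) → T ⊆ C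

theorem conn_iff (G : SimpleGraph V) (T : Set V) : (G.induce T).Connected ↔ Conn G T := by
  constructor
  · intro h
    refine ⟨Set.nonempty_coe_sort.1 h.nonempty, fun C hC hne hcl x hx => ?_⟩
    obtain ⟨c, hc⟩ := hne
    obtain ⟨p⟩ := h.preconnected ⟨c, hC hc⟩ ⟨x, hx⟩
    have key : ∀ (u w : T), (G.induce T).Walk u w → (u : V) ∈ C → (w : V) ∈ C := by
      intro u w p
      induction p with
      | nil => exact id
      | cons h _ ih => exact fun hu => ih (hcl _ hu _ (Subtype.property _) h)
    exact key _ _ p hc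
  · rintro ⟨⟨x, hx⟩, h⟩
    rw [connected_iff_exists_forall_reachable]
    refine ⟨⟨x, hx⟩, ?_⟩
    have := h {u | ∃ hu : u ∈ T, (G.induce T).Reachable ⟨x, hx⟩ ⟨u, hu⟩} (fun u hu => hu.1)
      ⟨x, hx, Reachable.refl _⟩ ?_
    · rintro ⟨u, hu⟩
      exact (this hu).2
    · rintro u ⟨hu, r⟩ w hw a
      refine ⟨hw, r.trans (Adj.reachable ?_)⟩
      exact a

theorem noCut_iff (G : SimpleGraph V) (S : Set V) : NoCutVtx G S ↔
    Conn G S ∧ ∀ v ∈ S, (S \ {v}).Nonempty → Conn G (S \ {v}) := by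
  unfold NoCutVtx
  simp only [conn_iff]

/-- The subgraph of `G` with the edges inside `X`. -/
def ind (G : SimpleGraph V) (X : Set V) : SimpleGraph V where
  Adj u w := G.Adj u w ∧ u ∈ X ∧ w ∈ X
  symm := ⟨fun _ _ h => ⟨h.1.symm, h.2.2, h.2.1⟩⟩
  loopless := ⟨fun _ h => G.irrefl h.1⟩

theorem ind_adj {G : SimpleGraph V} {X : Set V} {u w : V} :
    (ind G X).Adj u w ↔ G.Adj u w ∧ u ∈ X ∧ w ∈ X := Iff.rfl

/-- Noncrossing injective placement. -/
def NX (G : SimpleGraph V) (f : V → ℕ) : Prop :=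
  Function.Injective f ∧ ∀ a b c d : V, G.Adj a b → G.Adj c d →
      ¬ (f a < f c ∧ f c < f b ∧ f b < f d)

def Itv (S : Set V) (f : V → ℕ) (a b : V) : Set V := {u | u ∈ S ∧ f a ≤ f u ∧ f u ≤ f b}

structure Inv (G : SimpleGraph V) (S : Set V) (f : V → ℕ) (a b : V) : Prop where
  ha : a ∈ S
  hb : b ∈ S
  hab : f a < f b
  hin : ∀ u ∈ S, f a < f u → f u < f b → ∀ w ∈ S, G.Adj u w → f a ≤ f w ∧ f w ≤ f b
  hnb : ∃ w ∈ S, G.Adj a w ∧ f a < f w ∧ f w ≤ f b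

variable {G : SimpleGraph V} {S : Set V} {f : V → ℕ} {a b c : V}

theorem Inv.left (hf : NX G f) (h : Inv G S f a b) (hc : c ∈ S) (hac : G.Adj a c)
    (h1 : f a < f c) (h2 : f c < f b) : Inv G S f a c where
  ha := h.ha
  hb := hc
  hab := h1
  hin u hu u1 u2 w hw uw := by
    have := h.hin u hu u1 (u2.trans h2) w hw uw
    refine ⟨this.1, ?_⟩
    by_contra hh
    exact hf.2 a c u w hac uw ⟨u1, u2, by omega⟩
  hnb := ⟨c, hc, hac, h1, le_rfl⟩

theorem Inv.right (hf : NX G f) (hS : NoCutVtx G S) (h : Inv G S f a b) (hc : c ∈ S)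
    (hac : G.Adj a c) (h1 : f a < f c) (h2 : f c < f b)
    (hmax : ∀ d ∈ S, G.Adj a d → f d < f b → f d ≤ f c) : Inv G S f c b where
  ha := hc
  hb := h.hb
  hab := h2
  hin u hu u1 u2 w hw uw := by
    have := h.hin u hu (h1.trans u1) u2 w hw uw
    refine ⟨?_, this.2⟩
    by_contra hh
    by_cases e : w = a
    · subst e
      have := hmax u hu uw.symm u2
      omega
    · have : f w ≠ f a := fun e' => e (hf.1 e')
      exact hf.2 a c w u hac uw.symm ⟨by omega, by omega, u1⟩
  hnb := by
    by_contra hno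
    push Not at hno
    have hne : (S \ {a}).Nonempty := ⟨c, hc, fun e => by rw [Set.mem_singleton_iff] at e; subst e; omega⟩
    have hcn := ((noCut_iff G S).1 hS).2 a h.ha hne
    have hb' : b ∈ S \ {a} := ⟨h.hb, fun e => by
      rw [Set.mem_singleton_iff] at e; subst e; omega⟩
    have := hcn.2 {u | u ∈ S ∧ f a < f u ∧ f u ≤ f c} ?_ ⟨c, hc, h1, le_rfl⟩ ?_ hb'
    · have := this.2.2; omega
    · intro u hu
      exact ⟨hu.1, fun e => by
        rw [Set.mem_singleton_iff] at e; subst e; have := hu.2.1; omega⟩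
    · rintro u ⟨hu, u1, u2⟩ w ⟨hw, hwa⟩ uw
      have hwa' : f w ≠ f a := fun e => hwa (hf.1 e)
      by_cases e : u = c
      · subst e
        have := h.hin u hu h1 h2 w hw uw
        have h3 := hno w hw uw
        refine ⟨hw, by omega, ?_⟩
        by_contra h4
        have := h3 (by omega)
        omega
      · have e' : f u ≠ f c := fun e' => e (hf.1 e')
        have := (h.left hf hc hac h1 h2).hin u hu u1 (by omega) w hw uw
        exact ⟨hw, by omega, this.2⟩

theorem Inv.nbr (hf : NX G f) (hS : NoCutVtx G S) (h : Inv G S f a b)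
    (hmid : ∃ m ∈ S, f a < f m ∧ f m < f b) : ∃ c ∈ S, G.Adj a c ∧ f a < f c ∧ f c < f b := by
  by_contra hno
  push Not at hno
  have ha' : a ∈ S \ {b} := ⟨h.ha, fun e => by
      rw [Set.mem_singleton_iff] at e; have := h.hab; subst e; omega⟩
  have hcn := ((noCut_iff G S).1 hS).2 b h.hb ⟨a, ha'⟩
  obtain ⟨m, hm, m1, m2⟩ := hmid
  have := hcn.2 {u | u ∈ S ∧ f a < f u ∧ f u < f b} ?_ ⟨m, hm, m1, m2⟩ ?_ ha'
  · have := this.2.1; omega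
  · intro u hu
    exact ⟨hu.1, fun e => by
      rw [Set.mem_singleton_iff] at e; subst e; have := hu.2.2; omega⟩
  · rintro u ⟨hu, u1, u2⟩ w ⟨hw, hwb⟩ uw
    have hwb' : f w ≠ f b := fun e => hwb (hf.1 e)
    have h1 := h.hin u hu u1 u2 w hw uw
    refine ⟨hw, ?_, by omega⟩
    by_contra h2
    have : w = a := hf.1 (by omega)
    subst this
    have := hno u hu uw.symm u1
    omega

theorem exists_max [Finite V] (f : V → ℕ) (T : Set V) (h : T.Nonempty) :
    ∃ c ∈ T, ∀ d ∈ T, f d ≤ f c :=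
  Set.exists_max_image T f T.toFinite h

theorem exists_min [Finite V] (f : V → ℕ) (T : Set V) (h : T.Nonempty) :
    ∃ c ∈ T, ∀ d ∈ T, f c ≤ f d :=
  Set.exists_min_image T f T.toFinite h

theorem ind_split (hf : NX G f) (h : Inv G S f a b) (hc : c ∈ S)
    (hac : G.Adj a c) (h1 : f a < f c) (h2 : f c < f b)
    (hmax : ∀ d ∈ S, G.Adj a d → f d < f b → f d ≤ f c) :
    ind G (Itv S f a b) \ edge a b = ind G (Itv S f a c) ⊔ ind G (Itv S f c b) := by
  have key : ∀ u w, f u ≤ f w → ((ind G (Itv S f a b) \ edge a b).Adj u w ↔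
      (ind G (Itv S f a c) ⊔ ind G (Itv S f c b)).Adj u w) := by
    intro u w huw
    simp only [sdiff_adj, sup_adj, ind_adj, edge_adj, Itv, Set.mem_ofPred_eq]
    constructor
    · rintro ⟨⟨uw, ⟨hu, u1, u2⟩, hw, w1, w2⟩, hne⟩
      by_cases k1 : f w ≤ f c
      · exact Or.inl ⟨uw, ⟨hu, u1, by omega⟩, hw, w1, k1⟩
      by_cases k2 : f c ≤ f u
      · exact Or.inr ⟨uw, ⟨hu, k2, u2⟩, hw, by omega, w2⟩
      exfalso
      by_cases e : u = a
      · subst e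
        by_cases e2 : w = b
        · subst e2
          exact hne ⟨Or.inl ⟨rfl, rfl⟩, uw.ne⟩
        · have : f w ≠ f b := fun e' => e2 (hf.1 e')
          have := hmax w hw uw (by omega)
          omega
      · have : f u ≠ f a := fun e' => e (hf.1 e')
        exact hf.2 a c u w hac uw ⟨by omega, by omega, by omega⟩
    · rintro (⟨uw, ⟨hu, u1, u2⟩, hw, w1, w2⟩ | ⟨uw, ⟨hu, u1, u2⟩, hw, w1, w2⟩)
      · refine ⟨⟨uw, ⟨hu, u1, by omega⟩, hw, w1, by omega⟩, ?_⟩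
        rintro ⟨⟨rfl, rfl⟩ | ⟨rfl, rfl⟩, -⟩ <;> omega
      · refine ⟨⟨uw, ⟨hu, by omega, by omega⟩, hw, by omega, by omega⟩, ?_⟩
        rintro ⟨⟨rfl, rfl⟩ | ⟨rfl, rfl⟩, -⟩ <;> omega
  ext u w
  rcases le_total (f u) (f w) with h | h
  · exact key u w h
  · rw [adj_comm, key w u h, adj_comm]

theorem supp_ind (G : SimpleGraph V) (X : Set V) : ∀ u w, (ind G X).Adj u w → u ∈ X :=
  fun _ _ h => h.2.1

variable [Fintype V]

def PieceOK (G : SimpleGraph V) (S : Set V) (f : V → ℕ) (a b : V) : Prop :=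
  (G.Adj a b → ClaimE (ind G (Itv S f a b)) (Itv S f a b) a b) ∧
  (¬ G.Adj a b → ClaimN (ind G (Itv S f a b)) (Itv S f a b) a b)

theorem core (hf : NX G f) (hS : NoCutVtx G S) (h : Inv G S f a b)
    (ih : ∀ a' b', f b' - f a' < f b - f a → Inv G S f a' b' → PieceOK G S f a' b')
    (hmid : ∃ m ∈ S, f a < f m ∧ f m < f b) :
    ClaimN (ind G (Itv S f a b) \ edge a b) (Itv S f a b) a b := by
  obtain ⟨c, ⟨hc, hac, h1, h2⟩, hm⟩ := exists_max f {c | c ∈ S ∧ G.Adj a c ∧ f a < f c ∧ f c < f b}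
    (h.nbr hf hS hmid)
  have hmax : ∀ d ∈ S, G.Adj a d → f d < f b → f d ≤ f c := by
    intro d hd had hdb
    by_cases k : f a < f d
    · exact hm d ⟨hd, had, k, hdb⟩
    · omega
  have l := ih a c (by omega) (h.left hf hc hac h1 h2)
  have r := ih c b (by omega) (h.right hf hS hc hac h1 h2 hmax)
  rw [ind_split hf h hc hac h1 h2 hmax]
  have hU : Itv S f a b = Itv S f a c ∪ Itv S f c b := by
    ext u
    simp only [Itv, Set.mem_union, Set.mem_ofPred_eq]
    constructor
    · rintro ⟨hu, u1, u2⟩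
      rcases le_total (f u) (f c) with k | k
      · exact Or.inl ⟨hu, u1, k⟩
      · exact Or.inr ⟨hu, k, u2⟩
    · rintro (⟨hu, u1, u2⟩ | ⟨hu, u1, u2⟩)
      · exact ⟨hu, u1, by omega⟩
      · exact ⟨hu, by omega, u2⟩
  rw [hU]
  refine claim_series (z := c) (supp_ind _ _) (supp_ind _ _) ?_ ⟨h.ha, le_rfl, h1.le⟩
    (fun e => by subst e; omega) ⟨h.hb, h2.le, le_rfl⟩ (fun e => by subst e; omega) (l.1 hac) ?_
  · rintro u ⟨_, _, u2⟩ ⟨_, u3, _⟩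
    exact hf.1 (le_antisymm u2 u3)
  · by_cases k : G.Adj c b
    · exact Or.inl (r.1 k)
    · exact Or.inr (r.2 k)

theorem sdiff_sup_edge {H : SimpleGraph V} (h : H.Adj a b) : H \ edge a b ⊔ edge a b = H :=
  sdiff_sup_cancel (by rwa [edge_le_iff, or_iff_right h.ne])

theorem sdiff_edge_not {H : SimpleGraph V} (h : ¬ H.Adj a b) : H \ edge a b = H := by
  ext u w
  simp only [sdiff_adj, edge_adj, and_iff_left_iff_imp]
  rintro huw ⟨⟨rfl, rfl⟩ | ⟨rfl, rfl⟩, -⟩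
  · exact h huw
  · exact h huw.symm

theorem not_sdiff_edge {H : SimpleGraph V} (h : a ≠ b) : ¬ (H \ edge a b).Adj a b := by
  simp [sdiff_adj, edge_adj, h]

theorem piece (hf : NX G f) (hS : NoCutVtx G S) : ∀ n a b, f b - f a < n → Inv G S f a b →
    PieceOK G S f a b := by
  intro n
  induction n with
  | zero => intro a b h; omega
  | succ n ih =>
    intro a b hn h
    have hne : a ≠ b := fun e => by have := h.hab; subst e; omega
    by_cases hmid : ∃ m ∈ S, f a < f m ∧ f m < f b
    · have hc := core hf hS h (fun a' b' h1 h2 => ih a' b' (by omega) h2) hmid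
      constructor
      · intro hab
        have hi : (ind G (Itv S f a b)).Adj a b :=
          ⟨hab, ⟨h.ha, le_rfl, h.hab.le⟩, ⟨h.hb, h.hab.le, le_rfl⟩⟩
        have := claim_close hne (not_sdiff_edge hne) hc
        rwa [sdiff_sup_edge hi] at this
      · intro hab
        rwa [sdiff_edge_not (fun hh : (ind G (Itv S f a b)).Adj a b => hab hh.1)] at hc
    · push Not at hmid
      have hI : Itv S f a b = {a, b} := by
        ext u
        simp only [Itv, Set.mem_ofPred_eq, Set.mem_insert_iff, Set.mem_singleton_iff]
        constructor
        · rintro ⟨hu, u1, u2⟩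
          by_contra hh
          push Not at hh
          have e1 : f u ≠ f a := fun e => hh.1 (hf.1 e)
          have e2 : f u ≠ f b := fun e => hh.2 (hf.1 e)
          have := hmid u hu (by omega)
          omega
        · rintro (rfl | rfl)
          · exact ⟨h.ha, le_rfl, h.hab.le⟩
          · exact ⟨h.hb, h.hab.le, le_rfl⟩
      have hab : G.Adj a b := by
        obtain ⟨w, hw, aw, w1, w2⟩ := h.hnb
        have : b = w := hf.1 (by have := hmid w hw w1; omega)
        exact this ▸ aw
      refine ⟨fun _ => ?_, fun k => absurd hab k⟩
      have : ind G (Itv S f a b) = edge a b := by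
        rw [hI]
        ext u w
        simp only [ind_adj, edge_adj, Set.mem_insert_iff, Set.mem_singleton_iff]
        constructor
        · rintro ⟨uw, rfl | rfl, rfl | rfl⟩
          · exact absurd uw G.irrefl
          · exact ⟨Or.inl ⟨rfl, rfl⟩, uw.ne⟩
          · exact ⟨Or.inr ⟨rfl, rfl⟩, uw.ne⟩
          · exact absurd uw G.irrefl
        · rintro ⟨⟨rfl, rfl⟩ | ⟨rfl, rfl⟩, -⟩
          · exact ⟨hab, Or.inl rfl, Or.inr rfl⟩
          · exact ⟨hab.symm, Or.inr rfl, Or.inl rfl⟩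
      rw [this, hI]
      exact claimE_edge hne

theorem top (hf : NX G f) (hS : NoCutVtx G S) (ha : a ∈ S) (hb : b ∈ S) (hab : a ≠ b)
    (hmin : ∀ u ∈ S, f a ≤ f u) (hmax : ∀ u ∈ S, f u ≤ f b) :
    G.Adj a b ∧ ((∃ m ∈ S, m ≠ a ∧ m ≠ b) → ClaimN (ind G S \ edge a b) S a b) := by
  have hlt : f a < f b := lt_of_le_of_ne (hmin b hb) fun e => hab (hf.1 e)
  have hnb : ∃ w ∈ S, G.Adj a w ∧ f a < f w ∧ f w ≤ f b := by
    by_contra hno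
    push Not at hno
    have := ((noCut_iff G S).1 hS).1.2 {a} (by simpa using ha) ⟨a, rfl⟩ ?_ hb
    · exact hab this.symm
    · rintro u rfl w hw uw
      by_contra hwu
      have : f u ≠ f w := fun e => hwu (hf.1 e.symm)
      have h1 := hmin w hw
      have h2 := hmax w hw
      have := hno w hw uw (by omega)
      omega
  have hI : Inv G S f a b :=
    { ha := ha, hb := hb, hab := hlt, hnb := hnb
      hin := fun u _ _ _ w hw _ => ⟨hmin w hw, hmax w hw⟩ }
  have hItv : Itv S f a b = S := by
    ext u
    exact ⟨fun h => h.1, fun h => ⟨h, hmin u h, hmax u h⟩⟩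
  constructor
  · by_contra hnab
    obtain ⟨c, ⟨hc, hac⟩, hm⟩ := exists_max f {c | c ∈ S ∧ G.Adj a c}
      (by obtain ⟨w, h1, h2, _⟩ := hnb; exact ⟨w, h1, h2⟩)
    have hcb : b ≠ c := fun e => hnab (e ▸ hac)
    have hca : f a ≠ f c := fun e => hac.ne (hf.1 e)
    have hca' := hmin c hc
    have hb' : b ∈ S \ {c} := ⟨hb, hcb⟩
    have := (((noCut_iff G S).1 hS).2 c hc ⟨b, hb'⟩).2 {u | u ∈ S ∧ f u < f c} ?_
      ⟨a, ha, by omega⟩ ?_ hb'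
    · have h1 := this.2
      have h2 := hmax c hc
      omega
    · rintro u ⟨hu, h⟩
      exact ⟨hu, fun e => by rw [Set.mem_singleton_iff] at e; subst e; omega⟩
    · rintro u ⟨hu, u1⟩ w ⟨hw, hwc⟩ uw
      refine ⟨hw, ?_⟩
      by_contra h3
      have hwc' : f w ≠ f c := fun e => hwc (hf.1 e)
      by_cases e : u = a
      · subst e
        have := hm w ⟨hw, uw⟩
        omega
      · have e1 : f u ≠ f a := fun e' => e (hf.1 e')
        have e2 := hmin u hu
        exact hf.2 a c u w hac uw ⟨by omega, by omega, by omega⟩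
  · rintro ⟨m, hm, m1, m2⟩
    have := core hf hS hI (fun a' b' _ h2 => piece hf hS _ a' b' (Nat.lt_succ_self _) h2)
      ⟨m, hm, lt_of_le_of_ne (hmin m hm) fun e => m1 (hf.1 e).symm,
        lt_of_le_of_ne (hmax m hm) fun e => m2 (hf.1 e)⟩
    rwa [hItv] at this

end block
/-! ## Part 5: colorings of a single block -/

section blockcol
variable {V : Type*} [Fintype V] {G : SimpleGraph V} {S : Set V} {f : V → ℕ} {a b : V}

theorem path4_c5 (hab : G.Adj a b) (ha : a ∈ S) (hb : b ∈ S)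
    (h : PathP 4 (ind G S \ edge a b) S a b) : IsC5Block G S := by
  obtain ⟨z1, H2, X2, n1, ⟨z2, H3, X3, n2, ⟨z3, H4, X4, n3, ⟨rfl, rfl, n4⟩, rfl, rfl⟩, rfl, rfl⟩,
    hH, hS⟩ := h
  have hE : ∀ u w, u ∈ S → w ∈ S → (G.Adj u w ↔
      (edge a z1 ⊔ (edge z1 z2 ⊔ (edge z2 z3 ⊔ edge z3 b)) ⊔ edge a b).Adj u w) := by
    intro u w hu hw
    have hi : (ind G S).Adj a b := ⟨hab, ha, hb⟩
    rw [← hH, sdiff_sup_edge hi, ind_adj]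
    simp [hu, hw]
  simp only [Set.mem_insert_iff, Set.mem_singleton_iff, not_or] at n1 n2 n3
  have hg : ∀ i : Fin 5, ![a, z1, z2, z3, b] i ∈ S := by
    intro i
    rw [hS]
    fin_cases i <;> simp
  have hbij : Function.Bijective (fun i : Fin 5 => (⟨![a, z1, z2, z3, b] i, hg i⟩ : S)) := by
    constructor
    · intro i j hij
      have hij' : ![a, z1, z2, z3, b] i = ![a, z1, z2, z3, b] j := congrArg Subtype.val hij
      revert hij'
      fin_cases i <;> fin_cases j <;> simp <;> grind
    · rintro ⟨u, hu⟩
      have hu' := hu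
      rw [hS] at hu'
      simp only [Set.mem_insert_iff, Set.mem_singleton_iff] at hu'
      rcases hu' with rfl | rfl | rfl | rfl | rfl
      · exact ⟨0, rfl⟩
      · exact ⟨1, rfl⟩
      · exact ⟨2, rfl⟩
      · exact ⟨3, rfl⟩
      · exact ⟨4, rfl⟩
  have hadj : ∀ i j : Fin 5, G.Adj (![a, z1, z2, z3, b] i) (![a, z1, z2, z3, b] j) ↔
      (cycleGraph 5).Adj i j := by
    intro i j
    rw [hE _ _ (hg i) (hg j)]
    obtain ⟨k1, k2, k3, k4⟩ := n1
    obtain ⟨k5, k6, k7⟩ := n2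
    obtain ⟨k8, k9⟩ := n3
    simp only [sup_adj, edge_adj]
    have hc : ∀ i j : Fin 5, (cycleGraph 5).Adj i j ↔ (j = i + 1 ∨ i = j + 1) := by decide
    rw [hc]
    fin_cases i <;> fin_cases j <;> simp [*, Ne.symm, Ne.symm k1, Ne.symm k2, Ne.symm k3, Ne.symm k4, Ne.symm k5,
      Ne.symm k6, Ne.symm k7, Ne.symm k8, Ne.symm k9, Ne.symm n4]
  exact ⟨(⟨Equiv.ofBijective _ hbij, hadj _ _⟩ : cycleGraph 5 ≃g G.induce S).symm⟩

theorem ind_pair (hab : G.Adj a b) (ha : a ∈ S) (hb : b ∈ S)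
    (hno : ¬ ∃ m ∈ S, m ≠ a ∧ m ≠ b) : ind G S = edge a b := by
  push Not at hno
  ext u w
  rw [ind_adj, edge_adj]
  constructor
  · rintro ⟨uw, hu, hw⟩
    have h1 := hno u hu
    have h2 := hno w hw
    have := uw.ne
    grind
  · rintro ⟨⟨rfl, rfl⟩ | ⟨rfl, rfl⟩, -⟩
    · exact ⟨hab, ha, hb⟩
    · exact ⟨hab.symm, hb, ha⟩

theorem pair_col (hab : a ≠ b) : ∃ φ : V → Fin 4, IsProper4 (edge a b) φ ∧ φ a = 0 ∧ φ b = 1 := by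
  classical
  refine ⟨fun v => if v = a then 0 else 1, ?_, by simp, by simp [hab.symm]⟩
  intro u w h
  rw [edge_adj] at h
  rcases h.1 with ⟨rfl, rfl⟩ | ⟨rfl, rfl⟩
  · simp [h.2.symm]
  · simp [h.2]

theorem resR (hf : NX G f) (hS : NoCutVtx G S) (hn : S.Nontrivial) (h5 : ¬ IsC5Block G S) :
    ∃ φ, IsProper4 (ind G S) φ ∧ ∀ u ∈ S, par (ind G S) φ u ≠ 0 := by
  obtain ⟨a, ha, hmin⟩ := exists_min f S hn.nonempty
  obtain ⟨b, hb, hmax⟩ := exists_max f S hn.nonempty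
  have hab : a ≠ b := by
    rintro rfl
    obtain ⟨x, hx, y, hy, hxy⟩ := hn
    have e1 := hmin x hx
    have e2 := hmax x hx
    have e3 := hmin y hy
    have e4 := hmax y hy
    exact hxy (hf.1 (by omega))
  obtain ⟨hadj, hcl⟩ := top hf hS ha hb hab hmin hmax
  have hi : (ind G S).Adj a b := ⟨hadj, ha, hb⟩
  by_cases hmid : ∃ m ∈ S, m ≠ a ∧ m ≠ b
  · have := claim_odd hab (not_sdiff_edge hab) (hcl hmid) (fun h4 => h5 (path4_c5 hadj ha hb h4))
    rwa [sdiff_sup_edge hi] at this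
  · rw [ind_pair hadj ha hb hmid]
    obtain ⟨φ, h1, h2, h3⟩ := pair_col hab
    refine ⟨φ, h1, fun u hu => ?_⟩
    push Not at hmid
    by_cases e : u = a
    · rw [e, par_edge_left hab, h3]; decide
    · rw [hmid u hu e, par_edge_right hab, h2]; decide

theorem nx_rotate (hf : NX G f) (r : V) : ∃ f', NX G f' ∧ ∀ u, f' r ≤ f' u := by
  classical
  obtain ⟨m, -, hm⟩ := exists_max f Set.univ ⟨r, trivial⟩
  have hm' : ∀ u, f u ≤ f m := fun u => hm u trivial
  refine ⟨fun u => if f u < f r then f u + (f m + 1) else f u, ⟨?_, ?_⟩, ?_⟩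
  · intro u w h
    have h1 := hm' u
    have h2 := hm' w
    apply hf.1
    dsimp only at h
    split_ifs at h <;> omega
  · intro a b c d ab cd h
    have h1 := hm' a
    have h2 := hm' b
    have h3 := hm' c
    have h4 := hm' d
    have k1 := hf.2 a b c d ab cd
    have k2 := hf.2 b a d c ab.symm cd.symm
    have k3 := hf.2 c d b a cd ab.symm
    have k4 := hf.2 d c a b cd.symm ab
    dsimp only at h
    split_ifs at h <;> omega
  · intro u
    have := hm' r
    dsimp only
    split_ifs <;> omega

theorem resC (hf : NX G f) (hS : NoCutVtx G S) {r : V} (hr : r ∈ S) :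
    ∃ φ, IsProper4 (ind G S) φ ∧ (∀ u ∈ S, u ≠ r → par (ind G S) φ u ≠ 0) ∧
      ∃ i, i ≠ φ r ∧ par (ind G S) φ r i = 0 := by
  obtain ⟨g, hg, hmin⟩ := nx_rotate hf r
  obtain ⟨b, hb, hmax⟩ := exists_max g S ⟨r, hr⟩
  by_cases hab : r = b
  · subst hab
    have hS' : ∀ u ∈ S, u = r := fun u hu => hg.1 (le_antisymm (hmax u hu) (hmin u))
    have hno : ∀ u w, ¬ (ind G S).Adj u w := by
      rintro u w ⟨uw, hu, hw⟩
      rw [hS' u hu, hS' w hw] at uw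
      exact G.irrefl uw
    refine ⟨fun _ => 0, fun u w h => absurd h (hno u w), fun u hu h => absurd (hS' u hu) h, 1,
      by simp, ?_⟩
    rw [par_zero (hno r)]
    rfl
  obtain ⟨hadj, hcl⟩ := top hg hS hr hb hab (fun u _ => hmin u) hmax
  have hi : (ind G S).Adj r b := ⟨hadj, hr, hb⟩
  by_cases hmid : ∃ m ∈ S, m ≠ r ∧ m ≠ b
  · have := claim_even hab (not_sdiff_edge hab) (hcl hmid)
    rwa [sdiff_sup_edge hi] at this
  · rw [ind_pair hadj hr hb hmid]
    obtain ⟨φ, h1, h2, h3⟩ := pair_col hab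
    refine ⟨φ, h1, fun u hu hur => ?_, 2, ?_, ?_⟩
    · push Not at hmid
      rw [hmid u hu hur, par_edge_right hab, h2]; decide
    · rw [h2]; decide
    · rw [par_edge_left hab, h3]; decide

theorem c5_no (h5 : IsC5Block G S) {φ : V → Fin 4} (hφ : IsProper4 (ind G S) φ) :
    ∃ u ∈ S, par (ind G S) φ u = 0 := by
  obtain ⟨e⟩ := h5
  by_contra hno
  push Not at hno
  have hc : ∀ i j : Fin 5, (cycleGraph 5).Adj i j ↔ (j = i + 1 ∨ j = i + 4) := by decide
  have hadj : ∀ i j : Fin 5, G.Adj (e.symm i) (e.symm j) ↔ (cycleGraph 5).Adj i j :=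
    fun i j => e.symm.map_adj_iff
  have hp : ∀ i : Fin 5, φ (e.symm (i + 1)) ≠ φ (e.symm (i + 4)) := by
    intro i heq
    refine hno (e.symm i) (Subtype.property _) ?_
    rw [par_pair (x := (e.symm (i + 1) : V)) (y := (e.symm (i + 4) : V))]
    · rw [heq]
      exact CharTwo.add_self_eq_zero _
    · intro h
      have := e.symm.injective (Subtype.ext h)
      have hk : ∀ i : Fin 5, i + 1 = i + 4 → False := by decide
      exact hk i this
    · intro w
      rw [ind_adj]
      constructor
      · rintro ⟨h1, _, hw⟩
        obtain ⟨j, hj⟩ := e.symm.surjective ⟨w, hw⟩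
        have hj' : w = e.symm j := by rw [hj]
        rw [hj'] at h1 ⊢
        rw [hadj, hc] at h1
        rcases h1 with rfl | rfl
        · exact Or.inl rfl
        · exact Or.inr rfl
      · rintro (rfl | rfl)
        · exact ⟨(hadj _ _).2 ((hc _ _).2 (Or.inl rfl)), Subtype.property _, Subtype.property _⟩
        · exact ⟨(hadj _ _).2 ((hc _ _).2 (Or.inr rfl)), Subtype.property _, Subtype.property _⟩
  have hq : ∀ i : Fin 5, φ (e.symm i) ≠ φ (e.symm (i + 1)) := fun i =>
    hφ ⟨(hadj _ _).2 ((hc _ _).2 (Or.inl rfl)), Subtype.property _, Subtype.property _⟩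
  have hinj : Function.Injective (fun i : Fin 5 => φ (e.symm i)) := by
    intro i j hij
    by_contra hne
    have : j = i + 1 ∨ i = j + 1 ∨ (∃ k, i = k + 1 ∧ j = k + 4) ∨ (∃ k, j = k + 1 ∧ i = k + 4) := by
      revert hne; clear hij; revert i j; decide
    rcases this with rfl | rfl | ⟨k, rfl, rfl⟩ | ⟨k, rfl, rfl⟩
    · exact hq _ hij
    · exact hq _ hij.symm
    · exact hp _ hij
    · exact hp _ hij.symm
  have := Fintype.card_le_of_injective _ hinj
  simp at this

end blockcol
/-! ## Part 6: induction over blocks -/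

section blocks
variable {V : Type*} {G : SimpleGraph V} {U A B S T : Set V} {v : V}

def BlockIn (G : SimpleGraph V) (U S : Set V) : Prop :=
  S ⊆ U ∧ NoCutVtx G S ∧ ∀ T ⊆ U, S ⊆ T → NoCutVtx G T → T = S

/-- `U` is the union of `A` and `B`, which meet only in the cut vertex `v`. -/
structure Split (G : SimpleGraph V) (U A B : Set V) (v : V) : Prop where
  un : A ∪ B = U
  va : v ∈ A
  vb : v ∈ B
  cap : ∀ u ∈ A, u ∈ B → u = v
  nea : ∃ x ∈ A, x ≠ v
  neb : ∃ x ∈ B, x ≠ v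
  edg : ∀ u ∈ A, ∀ w ∈ B, G.Adj u w → u = v ∨ w = v

theorem Split.symm (h : Split G U A B v) : Split G U B A v where
  un := by rw [Set.union_comm]; exact h.un
  va := h.vb
  vb := h.va
  cap u hu hu' := h.cap u hu' hu
  nea := h.neb
  neb := h.nea
  edg u hu w hw uw := (h.edg w hw u hu uw.symm).symm

theorem Split.subA (h : Split G U A B v) : A ⊆ U := h.un ▸ Set.subset_union_left

theorem Split.connA (h : Split G U A B v) (hU : Conn G U) : Conn G A := by
  refine ⟨⟨v, h.va⟩, fun C hC hne hcl => ?_⟩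
  by_cases hv : v ∈ C
  · have := hU.2 (C ∪ B) ?_ ⟨v, Or.inl hv⟩ ?_
    · intro u hu
      rcases this (h.subA hu) with k | k
      · exact k
      · exact h.cap u hu k ▸ hv
    · rintro u (hu | hu)
      · exact h.subA (hC hu)
      · exact h.symm.subA hu
    · rintro u (hu | hu) w hw uw
      · rw [← h.un] at hw
        rcases hw with hw | hw
        · exact Or.inl (hcl u hu w hw uw)
        · exact Or.inr hw
      · rw [← h.un] at hw
        rcases hw with hw | hw
        · rcases h.edg w hw u hu uw.symm with rfl | rfl
          · exact Or.inl hv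
          · exact Or.inl (hcl u hv w hw uw)
        · exact Or.inr hw
  · exfalso
    refine hv (hU.2 C (hC.trans h.subA) hne ?_ (h.subA h.va))
    intro u hu w hw uw
    rw [← h.un] at hw
    rcases hw with hw | hw
    · exact hcl u hu w hw uw
    · rcases h.edg u (hC hu) w hw uw with rfl | rfl
      · exact absurd hu hv
      · exact hcl u hu w h.va uw

theorem exists_split (hU : Conn G U) (hn : ¬ NoCutVtx G U) : ∃ A B v, Split G U A B v := by
  classical
  rw [noCut_iff] at hn
  simp only [hU, true_and] at hn
  push Not at hn
  obtain ⟨v, hv, hne, hc⟩ := hn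
  unfold Conn at hc
  push Not at hc
  obtain ⟨C, hC, ⟨x, hx⟩, hcl, hnot⟩ := hc hne
  obtain ⟨y, hy, hyC⟩ := Set.not_subset.1 hnot
  have hvC : v ∉ C := fun h => (hC h).2 rfl
  refine ⟨insert v C, U \ C, v, ?_, by simp, ⟨hv, hvC⟩, ?_, ⟨x, by simp [hx], fun e => hvC (e ▸ hx)⟩,
    ⟨y, ⟨hy.1, hyC⟩, hy.2⟩, ?_⟩
  · ext u
    simp only [Set.mem_union, Set.mem_insert_iff, Set.mem_diff]
    constructor
    · rintro ((rfl | h) | h)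
      · exact hv
      · exact (hC h).1
      · exact h.1
    · intro h
      by_cases k : u ∈ C
      · exact Or.inl (Or.inr k)
      · exact Or.inr ⟨h, k⟩
  · rintro u (rfl | hu) hu'
    · rfl
    · exact absurd hu hu'.2
  · rintro u (rfl | hu) w hw uw
    · exact Or.inl rfl
    · right
      by_contra hwv
      exact hw.2 (hcl u hu w ⟨hw.1, hwv⟩ uw)

theorem Split.nc_sub (h : Split G U A B v) (hT : T ⊆ U) (hn : NoCutVtx G T) : T ⊆ A ∨ T ⊆ B := by
  by_contra hh
  push Not at hh
  obtain ⟨p, hp, hpA⟩ := Set.not_subset.1 hh.1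
  obtain ⟨q, hq, hqB⟩ := Set.not_subset.1 hh.2
  have hpv : p ≠ v := fun e => hpA (e ▸ h.va)
  have hqv : q ≠ v := fun e => hqB (e ▸ h.vb)
  have hqA : q ∈ A := by
    have := hT hq
    rw [← h.un] at this
    exact this.resolve_right hqB
  rw [noCut_iff] at hn
  have hc : Conn G (T \ {v}) := by
    by_cases hv : v ∈ T
    · exact hn.2 v hv ⟨p, hp, hpv⟩
    · rw [Set.diff_singleton_eq_self hv]; exact hn.1
  have := hc.2 ((T \ {v}) ∩ A) Set.inter_subset_left ⟨q, ⟨hq, hqv⟩, hqA⟩ ?_ ⟨hp, hpv⟩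
  · exact hpA this.2
  · rintro u ⟨⟨hu, huv⟩, huA⟩ w ⟨hw, hwv⟩ uw
    refine ⟨⟨hw, hwv⟩, ?_⟩
    have hwU := hT hw
    rw [← h.un] at hwU
    rcases hwU with k | k
    · exact k
    · rcases h.edg u huA w k uw with e | e
      · exact absurd e huv
      · exact absurd e hwv

theorem Split.block_down (h : Split G U A B v) (hS : BlockIn G U S) :
    BlockIn G A S ∨ BlockIn G B S := by
  rcases h.nc_sub hS.1 hS.2.1 with k | k
  · exact Or.inl ⟨k, hS.2.1, fun T hT => hS.2.2 T (hT.trans h.subA)⟩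
  · exact Or.inr ⟨k, hS.2.1, fun T hT => hS.2.2 T (hT.trans h.symm.subA)⟩

theorem conn_single (G : SimpleGraph V) (v : V) : Conn G {v} := by
  refine ⟨⟨v, rfl⟩, fun C hC ⟨c, hc⟩ _ => ?_⟩
  have : c = v := hC hc
  rintro u rfl
  exact this ▸ hc

theorem nc_pair {v w : V} (h : G.Adj v w) : NoCutVtx G {v, w} := by
  rw [noCut_iff]
  constructor
  · refine ⟨⟨v, by simp⟩, fun C hC ⟨c, hc⟩ hcl => ?_⟩
    have hcc := hC hc
    rintro u (rfl | rfl)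
    · rcases hcc with rfl | hcc
      · exact hc
      · have : c = w := hcc
        subst this
        exact hcl c hc u (by simp) h.symm
    · rcases hcc with rfl | hcc
      · exact hcl c hc u (by simp) h
      · have : c = u := hcc
        exact this ▸ hc
  · rintro x (rfl | rfl) _
    · have : ({x, w} : Set V) \ {x} = {w} := by ext u; simp; have := h.ne; grind
      rw [this]; exact conn_single G w
    · have : ({v, x} : Set V) \ {x} = {v} := by ext u; simp; have := h.ne; grind
      rw [this]; exact conn_single G v

theorem conn_nbr (hA : Conn G A) {v x : V} (hv : v ∈ A) (hx : x ∈ A) (hxv : x ≠ v) :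
    ∃ w ∈ A, G.Adj v w := by
  by_contra hno
  push Not at hno
  refine hxv (hA.2 {v} (by simpa using hv) ⟨v, rfl⟩ ?_ hx)
  rintro u rfl w hw uw
  exact absurd uw (hno w hw)

theorem Split.block_up (h : Split G U A B v) (hU : Conn G U) (hS : BlockIn G A S) :
    BlockIn G U S := by
  refine ⟨hS.1.trans h.subA, hS.2.1, fun T hT hST hn => ?_⟩
  rcases h.nc_sub hT hn with k | k
  · exact hS.2.2 T k hST hn
  · exfalso
    have hSv : ∀ u ∈ S, u = v := fun u hu => h.cap u (hS.1 hu) (k (hST hu))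
    obtain ⟨x, hx, hxv⟩ := h.nea
    obtain ⟨w, hw, vw⟩ := conn_nbr (h.connA hU) h.va hx hxv
    have := hS.2.2 {v, w} (by
        rintro u (rfl | rfl)
        · exact h.va
        · exact hw) (fun u hu => by rw [hSv u hu]; simp) (nc_pair vw)
    have hw' : w ∈ S := this ▸ (by simp)
    exact vw.ne (hSv w hw').symm

theorem Split.ind_eq (h : Split G U A B v) : ind G U = ind G A ⊔ ind G B := by
  ext u w
  rw [sup_adj, ind_adj, ind_adj, ind_adj]
  constructor
  · rintro ⟨uw, hu, hw⟩
    rw [← h.un] at hu hw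
    have k1 := h.edg u
    have k2 := h.edg w
    have k3 := h.va
    have k4 := h.vb
    have k5 := uw.symm
    simp only [Set.mem_union] at hu hw
    grind
  · rintro (⟨uw, hu, hw⟩ | ⟨uw, hu, hw⟩)
    · exact ⟨uw, h.subA hu, h.subA hw⟩
    · exact ⟨uw, h.symm.subA hu, h.symm.subA hw⟩

theorem fin_aux1 (c c' : Fin 4) (x y : Fin 4 → ZMod 2) (hxc : x c = 0) (hx : x ≠ 0)
    (hy : ∃ i, i ≠ c' ∧ y i = 0) :
    ∃ σ : Equiv.Perm (Fin 4), σ c' = c ∧ x + y ∘ σ.symm ≠ 0 := by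
  obtain ⟨τ, hτ⟩ : ∃ τ : Equiv.Perm (Fin 4), τ c' = c := ⟨_, Equiv.swap_apply_left c' c⟩
  by_cases h0 : x + y ∘ τ.symm ≠ 0
  · exact ⟨_, hτ, h0⟩
  · push Not at h0
    have hz : ∀ k, x k = y (τ.symm k) := fun k =>
      CharTwo.add_eq_zero.1 (congrFun h0 k)
    obtain ⟨j, hj⟩ := Function.ne_iff.1 hx
    obtain ⟨i, hi, hyi⟩ := hy
    have hjc : j ≠ c := fun e => hj (e ▸ hxc)
    have hic : τ i ≠ c := fun e => hi (τ.injective (e.trans hτ.symm))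
    refine ⟨τ.trans (Equiv.swap (τ i) j), ?_, ?_⟩
    · rw [Equiv.trans_apply, hτ, Equiv.swap_apply_of_ne_of_ne hic.symm hjc.symm]
    · intro e
      have := congrFun e (τ i)
      rw [Pi.add_apply, hz, Equiv.symm_apply_apply, hyi, Function.comp, Equiv.symm_trans_apply,
        Equiv.symm_swap, Equiv.swap_apply_left, ← hz, zero_add] at this
      exact hj this

theorem fin_aux2 (c c' : Fin 4) (x y : Fin 4 → ZMod 2) (hx : ∃ i, i ≠ c ∧ x i = 0)
    (hy : ∃ i, i ≠ c' ∧ y i = 0) :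
    ∃ σ : Equiv.Perm (Fin 4), σ c' = c ∧ ∃ k, k ≠ c ∧ (x + y ∘ σ.symm) k = 0 := by
  obtain ⟨τ, hτ⟩ : ∃ τ : Equiv.Perm (Fin 4), τ c' = c := ⟨_, Equiv.swap_apply_left c' c⟩
  obtain ⟨i, hi, hxi⟩ := hx
  obtain ⟨j, hj, hyj⟩ := hy
  have hic : τ j ≠ c := fun e => hj (τ.injective (e.trans hτ.symm))
  refine ⟨τ.trans (Equiv.swap (τ j) i), ?_, i, hi, ?_⟩
  · rw [Equiv.trans_apply, hτ, Equiv.swap_apply_of_ne_of_ne hic.symm hi.symm]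
  · rw [Pi.add_apply, hxi, Function.comp, Equiv.symm_trans_apply, Equiv.symm_swap,
      Equiv.swap_apply_right, Equiv.symm_apply_apply, hyj, zero_add]

theorem comp_ne_zero {y : Fin 4 → ZMod 2} (h : y ≠ 0) (σ : Equiv.Perm (Fin 4)) :
    y ∘ σ.symm ≠ 0 := by
  intro e
  apply h
  funext i
  have := congrFun e (σ i)
  simpa using this

variable [Fintype V]

theorem Split.glue (h : Split G U A B v) {φ1 φ2 : V → Fin 4} (p1 : IsProper4 (ind G A) φ1)
    (p2 : IsProper4 (ind G B) φ2) (σ : Equiv.Perm (Fin 4)) (hσ : σ (φ2 v) = φ1 v) :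
    ∃ φ, IsProper4 (ind G U) φ ∧ (∀ u ∈ A, φ u = φ1 u) ∧
      (∀ u ∈ A, u ≠ v → par (ind G U) φ u = par (ind G A) φ1 u) ∧
      (∀ u ∈ B, u ≠ v → par (ind G U) φ u = par (ind G B) φ2 u ∘ σ.symm) ∧
      par (ind G U) φ v = par (ind G A) φ1 v + par (ind G B) φ2 v ∘ σ.symm := by
  obtain ⟨φ, h1, h2, h3, h4, h5, h6⟩ := OddFour.glue (supp_ind G A) (supp_ind G B)
    (fun u hu hu' => h.cap u hu hu') p1 (proper_perm p2 σ) hσ.symm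
  rw [h.ind_eq]
  refine ⟨φ, h1, h2, h4, fun u hu huv => ?_, ?_⟩
  · rw [h5 u hu huv, par_perm]
  · rw [h6, par_perm]

def PropC (G : SimpleGraph V) (U : Set V) : Prop :=
  ∀ r ∈ U, ∃ φ, IsProper4 (ind G U) φ ∧ (∀ u ∈ U, u ≠ r → par (ind G U) φ u ≠ 0) ∧
      ∃ i, i ≠ φ r ∧ par (ind G U) φ r i = 0

def PropR (G : SimpleGraph V) (U : Set V) : Prop :=
  ∃ φ, IsProper4 (ind G U) φ ∧ (∀ u ∈ U, par (ind G U) φ u ≠ 0)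

theorem Split.propR (h : Split G U A B v) (hA : PropR G A) (hB : PropC G B) : PropR G U := by
  obtain ⟨φ1, p1, q1⟩ := hA
  obtain ⟨φ2, p2, q2, q3⟩ := hB v h.vb
  obtain ⟨σ, hσ, hne⟩ := fin_aux1 (φ1 v) (φ2 v) (par (ind G A) φ1 v) (par (ind G B) φ2 v)
    (par_self p1 v) (q1 v h.va) q3
  obtain ⟨φ, g1, g2, g3, g4, g5⟩ := h.glue p1 p2 σ hσ
  refine ⟨φ, g1, fun u hu => ?_⟩
  by_cases e : u = v
  · rw [e, g5]; exact hne
  · rw [← h.un] at hu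
    rcases hu with hu | hu
    · rw [g3 u hu e]; exact q1 u hu
    · rw [g4 u hu e]; exact comp_ne_zero (q2 u hu e) σ

theorem Split.propC_aux (h : Split G U A B v) (hA : PropC G A) (hB : PropC G B) {r : V}
    (hr : r ∈ A) : ∃ φ, IsProper4 (ind G U) φ ∧ (∀ u ∈ U, u ≠ r → par (ind G U) φ u ≠ 0) ∧
      ∃ i, i ≠ φ r ∧ par (ind G U) φ r i = 0 := by
  obtain ⟨φ1, p1, q1, k1⟩ := hA r hr
  obtain ⟨φ2, p2, q2, q3⟩ := hB v h.vb
  by_cases hrv : r = v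
  · subst hrv
    obtain ⟨σ, hσ, hne⟩ := fin_aux2 (φ1 r) (φ2 r) (par (ind G A) φ1 r) (par (ind G B) φ2 r) k1 q3
    obtain ⟨φ, g1, g2, g3, g4, g5⟩ := h.glue p1 p2 σ hσ
    refine ⟨φ, g1, fun u hu e => ?_, ?_⟩
    · rw [← h.un] at hu
      rcases hu with hu | hu
      · rw [g3 u hu e]; exact q1 u hu e
      · rw [g4 u hu e]; exact comp_ne_zero (q2 u hu e) σ
    · rw [g5, g2 r hr]; exact hne
  · obtain ⟨σ, hσ, hne⟩ := fin_aux1 (φ1 v) (φ2 v) (par (ind G A) φ1 v) (par (ind G B) φ2 v)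
      (par_self p1 v) (q1 v h.va (Ne.symm hrv)) q3
    obtain ⟨φ, g1, g2, g3, g4, g5⟩ := h.glue p1 p2 σ hσ
    refine ⟨φ, g1, fun u hu k => ?_, ?_⟩
    · by_cases e : u = v
      · rw [e, g5]; exact hne
      · rw [← h.un] at hu
        rcases hu with hu | hu
        · rw [g3 u hu e]; exact q1 u hu k
        · rw [g4 u hu e]; exact comp_ne_zero (q2 u hu e) σ
    · rw [g3 r hr hrv, g2 r hr]; exact k1

theorem Split.propC (h : Split G U A B v) (hA : PropC G A) (hB : PropC G B) : PropC G U := by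
  intro r hr
  rw [← h.un] at hr
  rcases hr with hr | hr
  · exact h.propC_aux hA hB hr
  · exact h.symm.propC_aux hB hA hr

theorem Split.lt (h : Split G U A B v) : A.ncard < U.ncard := by
  refine Set.ncard_lt_ncard ⟨h.subA, fun k => ?_⟩ U.toFinite
  obtain ⟨x, hx, hxv⟩ := h.neb
  exact hxv (h.cap x (k (h.symm.subA hx)) hx)

theorem propC_all {f : V → ℕ} (hf : NX G f) : ∀ n (U : Set V), U.ncard < n → Conn G U →
    PropC G U := by
  intro n
  induction n with
  | zero => intro U h; omega
  | succ n ih =>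
    intro U hn hU
    by_cases hc : NoCutVtx G U
    · exact fun r hr => resC hf hc hr
    · obtain ⟨A, B, v, h⟩ := exists_split hU hc
      have h1 := h.lt
      have h2 := h.symm.lt
      exact h.propC (ih A (by omega) (h.connA hU)) (ih B (by omega) (h.symm.connA hU))

theorem propR_all {f : V → ℕ} (hf : NX G f) : ∀ n (U : Set V), U.ncard < n → Conn G U →
    U.Nontrivial → (∃ S, BlockIn G U S ∧ ¬ IsC5Block G S) → PropR G U := by
  intro n
  induction n with
  | zero => intro U h; omega
  | succ n ih =>
    rintro U hn hU hnt ⟨S, hS, h5⟩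
    by_cases hc : NoCutVtx G U
    · have := hS.2.2 U subset_rfl hS.1 hc
      subst this
      exact resR hf hc hnt h5
    · obtain ⟨A, B, v, h⟩ := exists_split hU hc
      have key : ∀ A B, Split G U A B v → BlockIn G A S → PropR G U := by
        intro A B h hSA
        have h1 := h.lt
        have h2 := h.symm.lt
        obtain ⟨x, hx, hxv⟩ := h.nea
        exact h.propR (ih A (by omega) (h.connA hU) ⟨x, hx, v, h.va, hxv⟩ ⟨S, hSA, h5⟩)
          (propC_all hf _ B (Nat.lt_succ_self _) (h.symm.connA hU))
      rcases h.block_down hS with k | k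
      · exact key A B h k
      · exact key B A h.symm k

theorem no_all : ∀ n (U : Set V), U.ncard < n → Conn G U →
    (∀ S, BlockIn G U S → IsC5Block G S) → ∀ φ, IsProper4 (ind G U) φ →
    ∃ u ∈ U, par (ind G U) φ u = 0 := by
  intro n
  induction n with
  | zero => intro U h; omega
  | succ n ih =>
    rintro U hn hU hb φ hφ
    by_cases hc : NoCutVtx G U
    · exact c5_no (hb U ⟨subset_rfl, hc, fun T hT hT' _ => subset_antisymm hT hT'⟩) hφ
    · obtain ⟨A, B, v, h⟩ := exists_split hU hc
      have h1 := h.lt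
      have h2 := h.symm.lt
      have hφ' := hφ
      rw [h.ind_eq] at hφ'
      obtain ⟨a, ha, pa⟩ := ih A (by omega) (h.connA hU) (fun S hS => hb S (h.block_up hU hS)) φ
        (fun u w uw => hφ' (Or.inl uw))
      obtain ⟨b, hb', pb⟩ := ih B (by omega) (h.symm.connA hU)
        (fun S hS => hb S (h.symm.block_up hU hS)) φ (fun u w uw => hφ' (Or.inr uw))
      have hs : ∀ u, par (ind G U) φ u = par (ind G A) φ u + par (ind G B) φ u := by
        intro u
        rw [h.ind_eq]
        refine par_sup ?_ φ u
        rintro x y ⟨xy, x1, y1⟩ ⟨_, x2, y2⟩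
        exact xy.ne ((h.cap x x1 x2).trans (h.cap y y1 y2).symm)
      by_cases ea : a = v
      · by_cases eb : b = v
        · refine ⟨v, h.subA h.va, ?_⟩
          rw [hs, ← ea, pa, ea, ← eb, pb, add_zero]
        · refine ⟨b, h.symm.subA hb', ?_⟩
          rw [hs, pb, add_zero]
          exact par_zero fun w hw => eb (h.cap b hw.2.1 hb')
      · refine ⟨a, h.subA ha, ?_⟩
        rw [hs, pa, zero_add]
        exact par_zero fun w hw => ea (h.cap a ha hw.2.1)

end blocks
/-! ## Part 7: conclusion -/

theorem ind_univ {V : Type*} (G : SimpleGraph V) : ind G Set.univ = G := by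
  ext u w
  simp [ind_adj]

theorem blockIn_univ {V : Type*} (G : SimpleGraph V) (S : Set V) :
    BlockIn G Set.univ S ↔ IsBlock G S := by
  simp [BlockIn, IsBlock]

theorem conn_univ {V : Type*} {G : SimpleGraph V} (h : G.Connected) : Conn G Set.univ := by
  rw [← conn_iff]
  exact ((induceUnivIso G).connected_iff).2 h

theorem main {V : Type*} [Fintype V]
    (G : SimpleGraph V) (hconn : G.Connected) (hop : IsOuterplanar G) :
    (∃ φ : V → Fin 4, IsOdd4Coloring G φ) ↔
      ∃ S : Set V, IsBlock G S ∧ ¬ IsC5Block G S := by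
  obtain ⟨f, hf⟩ := hop
  have hU := conn_univ hconn
  constructor
  · rintro ⟨φ, hp, ho⟩
    by_contra hno
    push Not at hno
    have hb : ∀ S, BlockIn G Set.univ S → IsC5Block G S := fun S hS =>
      hno S ((blockIn_univ G S).1 hS)
    have hnt : ∀ u : V, ∃ w, G.Adj u w := by
      intro u
      by_contra hn
      push Not at hn
      have huniv : ∀ w, w = u := fun w => by
        refine hU.2 {u} (Set.subset_univ _) ⟨u, rfl⟩ ?_ (Set.mem_univ w)
        rintro x rfl w _ xw
        exact absurd xw (hn w)
      have hN : NoCutVtx G Set.univ := by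
        rw [noCut_iff]
        refine ⟨hU, fun v _ hne => ?_⟩
        obtain ⟨x, _, hx⟩ := hne
        exact absurd ((huniv x).trans (huniv v).symm) hx
      obtain ⟨e⟩ := hb Set.univ ⟨subset_rfl, hN, fun T _ h _ => Set.univ_subset_iff.1 h⟩
      have : e.symm 0 = e.symm 1 := Subtype.ext ((huniv _).trans (huniv _).symm)
      exact absurd (e.symm.injective this) (by decide)
    obtain ⟨u, -, hu⟩ := no_all _ Set.univ (Nat.lt_succ_self _) hU hb φ (by rwa [ind_univ])
    rw [ind_univ] at hu
    exact (oddAt_iff G φ u).1 (ho u (hnt u)) hu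
  · rintro ⟨S, hS, h5⟩
    by_cases hnt : (Set.univ : Set V).Nontrivial
    · obtain ⟨φ, h1, h2⟩ := propR_all hf _ Set.univ (Nat.lt_succ_self _) hU hnt
        ⟨S, (blockIn_univ G S).2 hS, h5⟩
      rw [ind_univ] at h1 h2
      exact ⟨φ, h1, fun v _ => (oddAt_iff G φ v).2 (h2 v trivial)⟩
    · rw [Set.not_nontrivial_iff] at hnt
      refine ⟨fun _ => 0, fun u w uw => absurd (hnt trivial trivial) uw.ne, ?_⟩
      rintro v ⟨w, vw⟩
      have vw' : G.Adj v w := vw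
      exact absurd (hnt trivial trivial) vw'.ne

end OddFour

theorem outerplanar_odd4colorable_iff {V : Type*} [Fintype V]
    (G : SimpleGraph V) (hconn : G.Connected) (hop : IsOuterplanar G) :
    (∃ φ : V → Fin 4, IsOdd4Coloring G φ) ↔
      ∃ S : Set V, IsBlock G S ∧ ¬ IsC5Block G S := by
  exact OddFour.main G hconn hop
end
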